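/- Let σ: [a,b] → ℝ² be a strict spiral occurring in a spiral decomposition of the unfolding of a minimal inspection curve. Then the efficiency satisfies E(σ) ≤ 2. Furthermore, if |σ(a)| < 1, then E(σ) < 2. -/

import Mathlib

open Real Set MeasureTheory ENNReal

noncomputable section


noncomputable section

abbrev E3 := EuclideanSpace ℝ (Fin 3)

/-- The lift of a curve `γ : ℝ/L → ℝ³` to `ℝ`, via the quotient map `ℝ → ℝ/L`. -/
def liftCurve (L : ℝ) (γ : AddCircle L → E3) : ℝ → E3 := fun s => γ s

/-- An inspection curve is a closed rectifiable curve `γ : ℝ/L → ℝ³`, parameterized with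
constant unit speed (`1`-Lipschitz with total variation `L` over one period), whose convex
hull contains the unit sphere centered at the origin. -/
def IsInspectionCurve (L : ℝ) (γ : AddCircle L → E3) : Prop :=
  0 < L ∧ Continuous γ ∧ LipschitzWith 1 (liftCurve L γ) ∧
    eVariationOn (liftCurve L γ) (Set.Icc 0 L) = ENNReal.ofReal L ∧
    Metric.sphere (0 : E3) 1 ⊆ convexHull ℝ (Set.range γ)

/-- A minimal inspection curve is an inspection curve of minimal length. -/
def IsMinInspectionCurve (L : ℝ) (γ : AddCircle L → E3) : Prop :=
  IsInspectionCurve L γ ∧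
    ∀ (L' : ℝ) (γ' : AddCircle L' → E3), IsInspectionCurve L' γ' → L ≤ L'

/-- The (almost-everywhere defined) derivative of the radial projection
`γ̄ = γ/|γ| : ℝ → S²` of the lifted curve. -/
def projDeriv (L : ℝ) (γ : AddCircle L → E3) : ℝ → E3 :=
  deriv fun s : ℝ => ‖liftCurve L γ s‖⁻¹ • liftCurve L γ s

/-- The arclength function `θ(t) = ∫₀ᵗ |γ̄'(s)| ds` of the radial projection of `γ`. -/
def thetaFn (L : ℝ) (γ : AddCircle L → E3) (t : ℝ) : ℝ :=
  ∫ u in (0:ℝ)..t, ‖projDeriv L γ u‖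

/-- `γt : [0,L] → ℝ² ≅ ℂ` is the unfolding of `γ : ℝ/L → ℝ³`: for the finitely many times
`0 = t₀ < t₁ < ⋯ < t_m = L` at which `γ` passes through the origin (together with the
distinguished endpoints `0` and `L`), one has
`γt(s) = |γ(s)| · e^{i(θ(s) + (k-1)π)}` for `s ∈ [t_{k-1}, t_k]`. -/
def IsUnfolding (L : ℝ) (γ : AddCircle L → E3) (γt : ℝ → ℂ) : Prop :=
  ∃ (m : ℕ) (tk : ℕ → ℝ), 0 < m ∧ StrictMonoOn tk (Set.Iic m) ∧
    tk 0 = 0 ∧ tk m = L ∧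
    (∀ s ∈ Set.Ioo (0:ℝ) L,
      (liftCurve L γ s = 0 ↔ ∃ k : ℕ, 0 < k ∧ k < m ∧ s = tk k)) ∧
    (∀ k : ℕ, 1 ≤ k → k ≤ m → ∀ s ∈ Set.Icc (tk (k-1)) (tk k),
      γt s = (‖liftCurve L γ s‖ : ℂ) *
        Complex.exp (Complex.I * Complex.ofReal (thetaFn L γ s + ((k : ℝ) - 1) * π)))

/-- The Euclidean dot product on `ℝ² ≅ ℂ`. -/
def dot2 (x y : ℂ) : ℝ := x.re * y.re + x.im * y.im

/-- `σ` has, at the point `σ t`, a local support line lying above `σ` (relative to the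
domain `D`): a line through `σ t` (with normal `n ≠ 0`) such that a neighborhood of `t`
in `D` is mapped into the side of the line containing the origin `o`. -/
def HasLocalSupportLineAbove (σ : ℝ → ℂ) (D : Set ℝ) (t : ℝ) : Prop :=
  ∃ n : ℂ, n ≠ 0 ∧ 0 ≤ dot2 n (σ t) ∧
    ∃ U ∈ nhdsWithin t D, ∀ s ∈ U, dot2 n (σ s) ≤ dot2 n (σ t)

/-- A planar curve `σ` is locally convex with respect to the origin `o` on `D` if it is
locally one-to-one on `D` and through each of its points there passes a local support
line which lies above `σ` (i.e. with the nearby part of `σ` on the side containing `o`). -/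
def LocConvexWrtOrigin (σ : ℝ → ℂ) (D : Set ℝ) : Prop :=
  (∀ t ∈ D, ∃ U ∈ nhdsWithin t D, Set.InjOn σ U) ∧
  (∀ t ∈ D, HasLocalSupportLineAbove σ D t)

/-- A (generalized) spiral: a constant-speed planar curve `σ : [a,b] → ℝ² ≅ ℂ` which is
(i) locally convex with respect to the origin, (ii) has `|σ|` nondecreasing, and
(iii) satisfies `⟨σ(a), σ'₊(a)⟩ = 0` for the one-sided derivative at `a`. -/
def IsSpiral (σ : ℝ → ℂ) (a b : ℝ) : Prop :=
  a < b ∧ ContinuousOn σ (Set.Icc a b) ∧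
  (∃ c : ℝ, ∀ᵐ s ∂(volume.restrict (Set.Icc a b)),
    ∃ v : ℂ, HasDerivAt σ v s ∧ ‖v‖ = c) ∧
  LocConvexWrtOrigin σ (Set.Icc a b) ∧
  MonotoneOn (fun s => ‖σ s‖) (Set.Icc a b) ∧
  ∃ v : ℂ, HasDerivWithinAt σ v (Set.Ici a) a ∧ dot2 (σ a) v = 0

/-- A strict spiral: a spiral with `|σ|` strictly increasing. -/
def IsStrictSpiral (σ : ℝ → ℂ) (a b : ℝ) : Prop :=
  IsSpiral σ a b ∧ StrictMonoOn (fun s => ‖σ s‖) (Set.Icc a b)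

/-- A spiral decomposition of a planar curve `γt : [0,L] → ℝ² ≅ ℂ`: a collection of
mutually disjoint (relatively) open subsets `U i` of `[0,L]` such that each restriction
of `γt` to `cl (U i) = [aᵢ, bᵢ]` is a strict spiral, after reversing direction if
necessary, and `|γt|' = 0` almost everywhere off `⋃ i, cl (U i)`. -/
def IsSpiralDecomp (L : ℝ) (γt : ℝ → ℂ) (ι : Type) (U : ι → Set ℝ) : Prop :=
  Pairwise (Function.onFun Disjoint U) ∧
  (∀ i, ∃ V : Set ℝ, IsOpen V ∧ U i = V ∩ Set.Icc 0 L) ∧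
  (∀ i, ∃ a b : ℝ, closure (U i) = Set.Icc a b ∧
    (IsStrictSpiral γt a b ∨ IsStrictSpiral (fun s => γt (a + b - s)) a b)) ∧
  (∀ᵐ s ∂(volume.restrict (Set.Icc 0 L \ ⋃ i, closure (U i))),
    HasDerivAt (fun u => ‖γt u‖) 0 s)

/-- The horizon of a planar curve `σ` (viewed in `ℝ² × {0} ⊂ ℝ³`) over the parameter set
`D`: the measure in `S²`, counted with multiplicity, of the set of points `p ∈ S²` whose
tangent plane `T_p S² = {x : ⟨x,p⟩ = 1}` meets `σ`; the measure on the unit sphere is the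
two-dimensional Hausdorff measure. -/
def horizonPlanar (σ : ℝ → ℂ) (D : Set ℝ) : ℝ≥0∞ :=
  ∫⁻ p in Metric.sphere (0 : E3) 1,
    (({t ∈ D | (σ t).re * p 0 + (σ t).im * p 1 = 1}).encard : ℝ≥0∞) ∂μH[2]

/-- The efficiency `E(σ) = H(σ)/L(σ)` of a planar curve `σ` over the parameter set `D`. -/
def effPlanar (σ : ℝ → ℂ) (D : Set ℝ) : ℝ≥0∞ :=
  horizonPlanar σ D / eVariationOn σ D

theorem lipschitzWith_of_periodic {E : Type*} [PseudoMetricSpace E] {F : ℝ → E} {ℓ : ℝ}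
    (hℓ : 0 < ℓ) (hper : Function.Periodic F ℓ)
    (hF : ∀ x ∈ Icc 0 ℓ, ∀ y ∈ Icc 0 ℓ, x ≤ y → dist (F x) (F y) ≤ y - x) :
    LipschitzWith 1 F := by
  have key : ∀ x y, x ≤ y → dist (F x) (F y) ≤ y - x := by
    intro x y hxy
    have hx := toIcoMod_mem_Ico hℓ 0 x
    rw [zero_add] at hx
    obtain ⟨x', hx', hFx, n, hn⟩ : ∃ x' ∈ Ico 0 ℓ, F x' = F x ∧ ∃ n : ℤ, x = x' + n * ℓ := by
      refine ⟨toIcoMod hℓ 0 x, hx, ?_, toIcoDiv hℓ 0 x, ?_⟩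
      · rw [toIcoMod]; exact hper.sub_zsmul_eq _
      · rw [toIcoMod, zsmul_eq_mul]; ring
    obtain ⟨y', hy', hFy, m, hm⟩ : ∃ y' ∈ Ico x' (x' + ℓ), F y' = F y ∧
        ∃ m : ℤ, y = y' + m * ℓ := by
      refine ⟨toIcoMod hℓ x' y, toIcoMod_mem_Ico hℓ x' y, ?_, toIcoDiv hℓ x' y, ?_⟩
      · rw [toIcoMod]; exact hper.sub_zsmul_eq _
      · rw [toIcoMod, zsmul_eq_mul]; ring
    have hnm : (n : ℝ) ≤ m := by
      by_contra! h
      have h' : (m : ℝ) + 1 ≤ n := by exact_mod_cast (by exact_mod_cast h : m < n)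
      nlinarith [hy'.2]
    have hle : y' - x' ≤ y - x := by nlinarith
    rw [← hFx, ← hFy]
    refine le_trans ?_ hle
    rcases le_total y' ℓ with h | h
    · exact hF _ ⟨hx'.1, hx'.2.le⟩ _ ⟨hx'.1.trans hy'.1, h⟩ hy'.1
    · have h1 := hF x' ⟨hx'.1, hx'.2.le⟩ ℓ ⟨hℓ.le, le_rfl⟩ hx'.2.le
      have h2 := hF 0 ⟨le_rfl, hℓ.le⟩ (y' - ℓ) ⟨by linarith, by linarith [hy'.2, hx'.2]⟩
        (by linarith)
      have h3 : F 0 = F ℓ := by simpa using (hper 0).symm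
      rw [h3, hper.sub_eq] at h2
      linarith [dist_triangle (F x') (F ℓ) (F y')]
  refine LipschitzWith.of_dist_le_mul fun x y => ?_
  rw [NNReal.coe_one, one_mul, Real.dist_eq]
  rcases le_total x y with h | h
  · rw [abs_sub_comm, abs_of_nonneg (sub_nonneg.2 h)]; exact key x y h
  · rw [dist_comm, abs_of_nonneg (sub_nonneg.2 h)]; exact key y x h

theorem eVariationOn_le_of_dist_le {E : Type*} [PseudoMetricSpace E] {g : ℝ → E} {Ψ : ℝ → ℝ}
    {s t : ℝ} (hst : s ≤ t)
    (h : ∀ u ∈ Icc s t, ∀ v ∈ Icc s t, u ≤ v → dist (g u) (g v) ≤ Ψ v - Ψ u) :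
    eVariationOn g (Icc s t) ≤ ENNReal.ofReal (Ψ t - Ψ s) := by
  have hmono : MonotoneOn Ψ (Icc s t) := fun u hu v hv huv =>
    sub_nonneg.1 (dist_nonneg.trans (h u hu v hv huv))
  have h1 : eVariationOn g (Icc s t) ≤ eVariationOn Ψ (Icc s t) := by
    refine iSup_le fun p => le_trans (Finset.sum_le_sum fun i _ => ?_)
      (eVariationOn.sum_le p.2.2.1 p.2.2.2)
    rw [edist_dist, edist_dist]
    refine ENNReal.ofReal_le_ofReal ?_
    rw [dist_comm]
    refine (h _ (p.2.2.2 i) _ (p.2.2.2 (i+1)) (p.2.2.1 (Nat.le_succ i))).trans ?_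
    exact le_abs_self _
  have h2 := (hmono.eVariationOn_eq (left_mem_Icc.2 hst) (right_mem_Icc.2 hst)).le
  rw [inter_self] at h2
  exact h1.trans h2

theorem IsMinInspectionCurve.le_of_closed_curve {L : ℝ} {γ : AddCircle L → E3}
    (hγ : IsMinInspectionCurve L γ) {g : ℝ → E3} {A B : ℝ} (hAB : A < B) {K : NNReal}
    (hg : LipschitzOnWith K g (Icc A B)) (hclosed : g A = g B)
    (hhull : Metric.sphere (0 : E3) 1 ⊆ convexHull ℝ (g '' Icc A B)) :
    L ≤ (eVariationOn g (Icc A B)).toReal := by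
  set s := Icc A B with hs
  have hA : A ∈ s := left_mem_Icc.2 hAB.le
  have hB : B ∈ s := right_mem_Icc.2 hAB.le
  have hbv : LocallyBoundedVariationOn g s := hg.locallyBoundedVariationOn
  have hfin : eVariationOn g s ≠ ∞ := by
    have := hbv A B hA hB
    rwa [hs, inter_self, ← hs] at this
  set φ := variationOnFromTo g s A with hφ
  set N := naturalParameterization g s A with hN
  set ℓ := (eVariationOn g s).toReal with hℓd
  have hφA : φ A = 0 := variationOnFromTo.self _ _ _
  have hφB : φ B = ℓ := by
    rw [hφ, variationOnFromTo.eq_of_le _ _ hAB.le, hs, inter_self]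
  have hNg : ∀ x ∈ s, N (φ x) = g x := fun x hx =>
    edist_le_zero.1 (edist_naturalParameterization_eq_zero hbv hA hx).le
  have hmono : MonotoneOn φ s := variationOnFromTo.monotoneOn hbv hA
  have hcont : ContinuousOn φ s := by
    refine LipschitzOnWith.continuousOn (K := K) (LipschitzOnWith.of_dist_le_mul ?_)
    have key : ∀ x ∈ s, ∀ y ∈ s, x ≤ y → dist (φ x) (φ y) ≤ K * dist x y := by
      intro x hx y hy hxy
      have h1 : φ x + variationOnFromTo g s x y = φ y := variationOnFromTo.add hbv hA hx hy
      have h2 : variationOnFromTo g s x y ≤ K * (y - x) := by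
        rw [variationOnFromTo.eq_of_le _ _ hxy]
        have hsub : s ∩ Icc x y = Icc x y := inter_eq_right.2 (Icc_subset_Icc hx.1 hy.2)
        rw [hsub]
        have := eVariationOn_le_of_dist_le (g := g) (Ψ := fun u => K * u) hxy (by
          intro u hu v hv huv
          have := hg.dist_le_mul u ⟨hx.1.trans hu.1, hu.2.trans hy.2⟩ v
            ⟨hx.1.trans hv.1, hv.2.trans hy.2⟩
          rw [Real.dist_eq, abs_sub_comm, abs_of_nonneg (sub_nonneg.2 huv)] at this
          linarith)
        have h3 := ENNReal.toReal_mono ENNReal.ofReal_ne_top this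
        rw [ENNReal.toReal_ofReal (by
          have := mul_nonneg K.2 (sub_nonneg.2 hxy); simp only [NNReal.val_eq_coe] at this; linarith)] at h3
        linarith
      have h4 := hmono hx hy hxy
      rw [Real.dist_eq, Real.dist_eq, abs_sub_comm, abs_of_nonneg (sub_nonneg.2 h4),
        abs_sub_comm, abs_of_nonneg (sub_nonneg.2 hxy)]
      linarith
    intro x hx y hy
    rcases le_total x y with h | h
    · exact key x hx y hy h
    · rw [dist_comm, dist_comm x y]; exact key y hy x hx h
  have himg : φ '' s = Icc 0 ℓ := by
    apply Subset.antisymm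
    · rintro _ ⟨x, hx, rfl⟩
      exact ⟨hφA ▸ hmono hA hx hx.1, hφB ▸ hmono hx hB hx.2⟩
    · have := intermediate_value_Icc hAB.le hcont
      rwa [hφA, hφB] at this
  have hunit : HasUnitSpeedOn N (Icc 0 ℓ) := himg ▸ has_unit_speed_naturalParameterization g hbv hA
  have hℓ0 : 0 ≤ ℓ := ENNReal.toReal_nonneg
  have hNimg : N '' Icc 0 ℓ = g '' s := by
    rw [← himg, image_image]; exact image_congr hNg
  have hℓ : 0 < ℓ := by
    refine hℓ0.lt_of_ne fun h => ?_
    have h1 : g '' s = {N 0} := by rw [← hNimg, ← h]; simp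
    rw [h1, convexHull_singleton] at hhull
    have e1 : (EuclideanSpace.single 0 1 : E3) = N 0 := hhull (by simp)
    have e2 : (EuclideanSpace.single 1 1 : E3) = N 0 := hhull (by simp)
    have := congrArg (fun v : E3 => v 0) (e1.trans e2.symm)
    simp at this
  have hend : N 0 = N ℓ := by
    rw [← hφA, hNg A hA, ← hφB, hNg B hB, hclosed]
  have hdist : ∀ x ∈ Icc 0 ℓ, ∀ y ∈ Icc 0 ℓ, x ≤ y → dist (N x) (N y) ≤ y - x := by
    intro x hx y hy hxy
    have h1 := hunit hx hy
    have hsub : Icc 0 ℓ ∩ Icc x y = Icc x y := inter_eq_right.2 (Icc_subset_Icc hx.1 hy.2)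
    rw [hsub, NNReal.coe_one, one_mul] at h1
    have h2 := eVariationOn.edist_le N (left_mem_Icc.2 hxy) (right_mem_Icc.2 hxy)
    rw [h1, edist_dist] at h2
    exact (ENNReal.ofReal_le_ofReal_iff (sub_nonneg.2 hxy)).1 h2
  have : Fact (0 < ℓ) := ⟨hℓ⟩
  set γ' : AddCircle ℓ → E3 := AddCircle.liftIco ℓ 0 N with hγ'
  have hval : ∀ x ∈ Icc 0 ℓ, liftCurve ℓ γ' x = N x := by
    intro x hx
    rcases hx.2.lt_or_eq with h | h
    · exact AddCircle.liftIco_zero_coe_apply ⟨hx.1, h⟩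
    · have : ((x : ℝ) : AddCircle ℓ) = ((0 : ℝ) : AddCircle ℓ) := by
        rw [h, AddCircle.coe_period, QuotientAddGroup.mk_zero]
      rw [liftCurve, this, h, ← hend]
      exact AddCircle.liftIco_zero_coe_apply ⟨le_rfl, hℓ⟩
  have hlip : LipschitzWith 1 (liftCurve ℓ γ') := by
    refine lipschitzWith_of_periodic hℓ (fun x => ?_) ?_
    · simp [liftCurve]
    · intro x hx y hy hxy
      rw [hval x hx, hval y hy]; exact hdist x hx y hy hxy
  refine hγ.2 ℓ γ' ⟨hℓ, ?_, hlip, ?_, ?_⟩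
  · exact AddCircle.liftIco_zero_continuous hend
      (hlip.continuous.continuousOn.congr fun x hx => (hval x hx).symm)
  · rw [eVariationOn.congr (fun x hx => hval x hx)]
    have h1 := hunit (left_mem_Icc.2 hℓ0) (right_mem_Icc.2 hℓ0)
    rwa [inter_self, NNReal.coe_one, one_mul, sub_zero] at h1
  · refine hhull.trans (convexHull_mono ?_)
    rw [← hNimg]
    rintro _ ⟨x, hx, rfl⟩
    exact ⟨(x : AddCircle ℓ), hval x hx⟩

theorem dist_le_sub_of_Icc_of_Icc {E : Type*} [PseudoMetricSpace E] {g : ℝ → E} {a b c : ℝ}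
    (h₁ : ∀ u ∈ Icc a b, ∀ v ∈ Icc a b, u ≤ v → dist (g u) (g v) ≤ v - u)
    (h₂ : ∀ u ∈ Icc b c, ∀ v ∈ Icc b c, u ≤ v → dist (g u) (g v) ≤ v - u) :
    ∀ u ∈ Icc a c, ∀ v ∈ Icc a c, u ≤ v → dist (g u) (g v) ≤ v - u := by
  intro u hu v hv huv
  rcases le_total v b with h | h
  · exact h₁ u ⟨hu.1, huv.trans h⟩ v ⟨hv.1, h⟩ huv
  rcases le_total b u with h' | h'
  · exact h₂ u ⟨h', hu.2⟩ v ⟨h, hv.2⟩ huv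
  have e1 := h₁ u ⟨hu.1, h'⟩ b ⟨hu.1.trans h', le_rfl⟩ h'
  have e2 := h₂ b ⟨le_rfl, h.trans hv.2⟩ v ⟨h, hv.2⟩ h
  linarith [dist_triangle (g u) (g b) (g v)]

theorem Convex.add_smul_mem_of_abs_le {E : Type*} [AddCommGroup E] [Module ℝ E] {C : Set E}
    (hC : Convex ℝ C) {u d : E} {b w : ℝ} (h₁ : u + w • d ∈ C) (h₂ : u + (-w) • d ∈ C)
    (hb : |b| ≤ w) : u + b • d ∈ C := by
  rcases (abs_nonneg b |>.trans hb).eq_or_lt with h | h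
  · have : b = w := by rw [← h] at hb ⊢; exact abs_nonpos_iff.1 hb
    rwa [this]
  · have hb' := abs_le.1 hb
    have := hC h₁ h₂ (a := (w + b) / (2 * w)) (b := (w - b) / (2 * w))
      (div_nonneg (by linarith) (by linarith)) (div_nonneg (by linarith) (by linarith))
      (by field_simp; ring)
    convert this using 1
    match_scalars <;> field_simp <;> ring

/-- A closed curve of length `4 * π`, made of four half circles on the sphere of radius `√2`,
whose convex hull contains the unit ball. -/
def baseballCurve (s : ℝ) : E3 :=
  if s ≤ π then !₂[1, -cos s, sin s] else
  if s ≤ 2 * π then !₂[-cos s, 1, sin s] else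
  if s ≤ 3 * π then !₂[-1, cos s, sin s] else !₂[cos s, -1, sin s]

theorem baseballCurve_of_mem_Icc₁ {s : ℝ} (hs : s ∈ Icc 0 π) :
    baseballCurve s = !₂[1, -cos s, sin s] := if_pos hs.2

theorem baseballCurve_of_mem_Icc₂ {s : ℝ} (hs : s ∈ Icc π (2 * π)) :
    baseballCurve s = !₂[-cos s, 1, sin s] := by
  rcases hs.1.eq_or_lt with h | h
  · rw [← h, baseballCurve, if_pos le_rfl]; simp
  · rw [baseballCurve, if_neg h.not_ge, if_pos hs.2]

theorem cos_three_mul_pi : cos (3 * π) = -1 := by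
  rw [show 3 * π = π + 2 * π by ring, cos_add_two_pi, cos_pi]

theorem baseballCurve_of_mem_Icc₃ {s : ℝ} (hs : s ∈ Icc (2 * π) (3 * π)) :
    baseballCurve s = !₂[-1, cos s, sin s] := by
  have := pi_pos
  rcases hs.1.eq_or_lt with h | h
  · rw [← h, baseballCurve, if_neg (by linarith), if_pos le_rfl]; simp
  · rw [baseballCurve, if_neg (by linarith), if_neg h.not_ge, if_pos hs.2]

theorem baseballCurve_of_mem_Icc₄ {s : ℝ} (hs : s ∈ Icc (3 * π) (4 * π)) :
    baseballCurve s = !₂[cos s, -1, sin s] := by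
  have := pi_pos
  rcases hs.1.eq_or_lt with h | h
  · rw [← h, baseballCurve, if_neg (by linarith), if_neg (by linarith), if_pos le_rfl]
    simp [cos_three_mul_pi]
  · rw [baseballCurve, if_neg (by linarith), if_neg (by linarith), if_neg h.not_ge]

theorem cos_sub_sq_add_sin_sub_sq_le (u v : ℝ) :
    (cos u - cos v) ^ 2 + (sin u - sin v) ^ 2 ≤ (v - u) ^ 2 := by
  have h1 := Real.one_sub_sq_div_two_le_cos (x := v - u)
  rw [cos_sub] at h1
  nlinarith [sin_sq_add_cos_sq u, sin_sq_add_cos_sq v]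

theorem dist_baseballCurve_le : ∀ u ∈ Icc 0 (4 * π), ∀ v ∈ Icc 0 (4 * π), u ≤ v →
    dist (baseballCurve u) (baseballCurve v) ≤ v - u := by
  refine dist_le_sub_of_Icc_of_Icc (b := 2 * π)
    (dist_le_sub_of_Icc_of_Icc (b := π) ?_ ?_) (dist_le_sub_of_Icc_of_Icc (b := 3 * π) ?_ ?_) <;>
  · intro u hu v hv huv
    simp only [baseballCurve_of_mem_Icc₁, baseballCurve_of_mem_Icc₂, baseballCurve_of_mem_Icc₃,
      baseballCurve_of_mem_Icc₄, hu, hv]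
    rw [EuclideanSpace.dist_eq, Real.sqrt_le_left (sub_nonneg.2 huv)]
    simp only [Fin.sum_univ_three, Real.dist_eq, sq_abs]
    have := cos_sub_sq_add_sin_sub_sq_le u v
    simp
    linarith

theorem sphere_subset_convexHull_baseballCurve :
    Metric.sphere (0 : E3) 1 ⊆ convexHull ℝ (baseballCurve '' Icc 0 (4 * π)) := by
  intro p hp
  have hπ := pi_pos
  set C := convexHull ℝ (baseballCurve '' Icc 0 (4 * π)) with hCd
  have hC : Convex ℝ C := convex_convexHull ℝ _
  have hp1 : p 0 ^ 2 + p 1 ^ 2 + p 2 ^ 2 = 1 := by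
    have : ‖p‖ = 1 := by simpa using hp
    rw [EuclideanSpace.norm_eq, Real.sqrt_eq_one] at this
    simpa [Fin.sum_univ_three] using this
  have hpe : p = !₂[p 0, p 1, p 2] := by ext i; fin_cases i <;> rfl
  have hin : ∀ s ∈ Icc 0 (4 * π), baseballCurve s ∈ C := fun s hs =>
    subset_convexHull ℝ _ ⟨s, hs, rfl⟩
  have hsq : ∀ x c : ℝ, x ^ 2 + c ^ 2 = 1 → 0 ≤ c → -1 ≤ x ∧ x ≤ 1 ∧ √(1 - x ^ 2) = c := by
    intro x c h hc
    refine ⟨by nlinarith [sq_nonneg c], by nlinarith [sq_nonneg c], ?_⟩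
    rw [show 1 - x ^ 2 = c ^ 2 by linarith, Real.sqrt_sq hc]
  have m1 : ∀ x c : ℝ, x ^ 2 + c ^ 2 = 1 → 0 ≤ c → (!₂[1, x, c] : E3) ∈ C := by
    intro x c h hc
    obtain ⟨hx1, hx2, hx3⟩ := hsq x c h hc
    have hs : arccos (-x) ∈ Icc 0 π := ⟨arccos_nonneg _, arccos_le_pi _⟩
    have := hin _ ⟨hs.1, hs.2.trans (by linarith)⟩
    rwa [baseballCurve_of_mem_Icc₁ hs, cos_arccos (by linarith) (by linarith), sin_arccos,
      neg_neg, neg_sq, hx3] at this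
  have m3 : ∀ x c : ℝ, x ^ 2 + c ^ 2 = 1 → 0 ≤ c → (!₂[-1, x, c] : E3) ∈ C := by
    intro x c h hc
    obtain ⟨hx1, hx2, hx3⟩ := hsq x c h hc
    have h1 := arccos_nonneg x
    have h2 := arccos_le_pi x
    have hs : arccos x + 2 * π ∈ Icc (2 * π) (3 * π) := ⟨by linarith, by linarith⟩
    have := hin _ ⟨by linarith [hs.1], hs.2.trans (by linarith)⟩
    rwa [baseballCurve_of_mem_Icc₃ hs, cos_add_two_pi, sin_add_two_pi,
      cos_arccos (by linarith) (by linarith), sin_arccos, hx3] at this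
  have m2 : ∀ x c : ℝ, x ^ 2 + c ^ 2 = 1 → 0 ≤ c → (!₂[x, 1, -c] : E3) ∈ C := by
    intro x c h hc
    obtain ⟨hx1, hx2, hx3⟩ := hsq x c h hc
    have h1 := arccos_nonneg (-x)
    have h2 := arccos_le_pi (-x)
    have hs : 2 * π - arccos (-x) ∈ Icc π (2 * π) := ⟨by linarith, by linarith⟩
    have := hin _ ⟨by linarith [hs.1], hs.2.trans (by linarith)⟩
    rwa [baseballCurve_of_mem_Icc₂ hs, cos_two_pi_sub, sin_two_pi_sub,
      cos_arccos (by linarith) (by linarith), sin_arccos, neg_neg, neg_sq, hx3] at this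
  have m4 : ∀ x c : ℝ, x ^ 2 + c ^ 2 = 1 → 0 ≤ c → (!₂[x, -1, -c] : E3) ∈ C := by
    intro x c h hc
    obtain ⟨hx1, hx2, hx3⟩ := hsq x c h hc
    have h1 := arccos_nonneg x
    have h2 := arccos_le_pi x
    have hs : 2 * π - arccos x + 2 * π ∈ Icc (3 * π) (4 * π) := ⟨by linarith, by linarith⟩
    have := hin _ ⟨by linarith [hs.1], hs.2⟩
    rwa [baseballCurve_of_mem_Icc₄ hs, cos_add_two_pi, sin_add_two_pi, cos_two_pi_sub,
      sin_two_pi_sub, cos_arccos (by linarith) (by linarith), sin_arccos, hx3] at this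
  have hc2 : 0 ≤ 1 - p 2 ^ 2 := by nlinarith [sq_nonneg (p 0), sq_nonneg (p 1)]
  set w := √(1 - p 2 ^ 2) with hw
  have hw2 : w ^ 2 + p 2 ^ 2 = 1 := by rw [hw, Real.sq_sqrt hc2]; ring
  have hw2' : (-w) ^ 2 + p 2 ^ 2 = 1 := by rw [neg_sq, hw2]
  have ha : |p 0| ≤ w := abs_le_of_sq_le_sq (by nlinarith [sq_nonneg (p 1)]) (sqrt_nonneg _)
  have hb : |p 1| ≤ w := abs_le_of_sq_le_sq (by nlinarith [sq_nonneg (p 0)]) (sqrt_nonneg _)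
  have hw1 : w ≤ 1 := by nlinarith [sq_nonneg (p 2), sqrt_nonneg (1 - p 2 ^ 2)]
  have dir0 : ∀ x y z : ℝ, (!₂[x, y, z] : E3) = !₂[0, y, z] + x • !₂[1, 0, 0] := by
    intro x y z; ext i; fin_cases i <;> simp
  have dir1 : ∀ x y z : ℝ, (!₂[x, y, z] : E3) = !₂[x, 0, z] + y • !₂[0, 1, 0] := by
    intro x y z; ext i; fin_cases i <;> simp
  rw [hpe]
  rcases le_total 0 (p 2) with h | h
  · have n1 : (!₂[1, p 1, p 2] : E3) ∈ C := by
      rw [dir1]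
      refine hC.add_smul_mem_of_abs_le ?_ ?_ hb <;> rw [← dir1]
      exacts [m1 _ _ hw2 h, m1 _ _ hw2' h]
    have n2 : (!₂[-1, p 1, p 2] : E3) ∈ C := by
      rw [dir1]
      refine hC.add_smul_mem_of_abs_le ?_ ?_ hb <;> rw [← dir1]
      exacts [m3 _ _ hw2 h, m3 _ _ hw2' h]
    rw [dir0]
    refine hC.add_smul_mem_of_abs_le ?_ ?_ (ha.trans hw1) <;> rw [← dir0]
    exacts [n1, n2]
  · have h' : 0 ≤ -p 2 := by linarith
    rw [← neg_sq (p 2)] at hw2 hw2'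
    have n1 : (!₂[p 0, 1, p 2] : E3) ∈ C := by
      rw [dir0]
      refine hC.add_smul_mem_of_abs_le ?_ ?_ ha <;> rw [← dir0, ← neg_neg (p 2)]
      exacts [m2 _ _ hw2 h', m2 _ _ hw2' h']
    have n2 : (!₂[p 0, -1, p 2] : E3) ∈ C := by
      rw [dir0]
      refine hC.add_smul_mem_of_abs_le ?_ ?_ ha <;> rw [← dir0, ← neg_neg (p 2)]
      exacts [m4 _ _ hw2 h', m4 _ _ hw2' h']
    rw [dir1]
    refine hC.add_smul_mem_of_abs_le ?_ ?_ (hb.trans hw1) <;> rw [← dir1]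
    exacts [n1, n2]

theorem IsMinInspectionCurve.length_le {L : ℝ} {γ : AddCircle L → E3}
    (hγ : IsMinInspectionCurve L γ) : L ≤ 4 * π := by
  have hπ := pi_pos
  have hlip : LipschitzOnWith 1 baseballCurve (Icc 0 (4 * π)) := by
    refine LipschitzOnWith.of_dist_le_mul fun u hu v hv => ?_
    rw [NNReal.coe_one, one_mul, Real.dist_eq]
    rcases le_total u v with h | h
    · rw [abs_sub_comm, abs_of_nonneg (sub_nonneg.2 h)]; exact dist_baseballCurve_le u hu v hv h
    · rw [dist_comm, abs_of_nonneg (sub_nonneg.2 h)]; exact dist_baseballCurve_le v hv u hu h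
  have h1 := hγ.le_of_closed_curve (by positivity) hlip ?_ sphere_subset_convexHull_baseballCurve
  · have h2 := eVariationOn_le_of_dist_le (Ψ := id) (by positivity) dist_baseballCurve_le
    have h3 := ENNReal.toReal_mono ENNReal.ofReal_ne_top h2
    rw [ENNReal.toReal_ofReal (by simp; positivity)] at h3
    simpa using h1.trans h3
  · rw [baseballCurve_of_mem_Icc₁ ⟨le_rfl, hπ.le⟩,
      baseballCurve_of_mem_Icc₄ ⟨by linarith, le_rfl⟩, show 4 * π = 0 + 2 * π + 2 * π by ring]
    simp only [cos_add_two_pi, sin_add_two_pi]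
    simp

theorem convexHull_image_subset_of_one_le {E : Type*} [AddCommGroup E] [Module ℝ E] {S : Set ℝ}
    {f : ℝ → E} {l : ℝ → ℝ} (hl : ∀ u ∈ S, 1 ≤ l u) (h0 : (0 : E) ∈ convexHull ℝ (f '' S)) :
    convexHull ℝ (f '' S) ⊆ convexHull ℝ ((fun u => l u • f u) '' S) := by
  set C := convexHull ℝ ((fun u => l u • f u) '' S) with hCd
  have hC : Convex ℝ C := convex_convexHull ℝ _
  have hin : ∀ u ∈ S, l u • f u ∈ C := fun u hu => subset_convexHull ℝ _ ⟨u, hu, rfl⟩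
  have hD : Convex ℝ {x : E | ∃ t : ℝ, 0 < t ∧ t • x ∈ C} := by
    rintro x ⟨t, ht, htx⟩ y ⟨s, hs, hsy⟩ α β hα hβ hαβ
    have hw : 0 < α / t + β / s := by
      rcases hα.eq_or_lt with h | h
      · have : β = 1 := by linarith
        rw [← h, this]; positivity
      · positivity
    refine ⟨(α / t + β / s)⁻¹, by positivity, ?_⟩
    have := hC htx hsy (a := α / t / (α / t + β / s)) (b := β / s / (α / t + β / s))
      (by positivity) (by positivity) (by rw [← add_div, div_self hw.ne'])
    convert this using 1
    simp only [smul_add, smul_smul]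
    congr 2 <;> field_simp
  have h0C : (0 : E) ∈ C := by
    have hsub : f '' S ⊆ {x : E | ∃ t : ℝ, 0 < t ∧ t • x ∈ C} := by
      rintro _ ⟨u, hu, rfl⟩
      exact ⟨l u, by linarith [hl u hu], hin u hu⟩
    obtain ⟨t, -, ht⟩ := convexHull_min hsub hD h0
    rwa [smul_zero] at ht
  refine convexHull_min ?_ hC
  rintro _ ⟨u, hu, rfl⟩
  have hlu := hl u hu
  have := hC (hin u hu) h0C (a := (l u)⁻¹) (b := 1 - (l u)⁻¹) (by positivity)
    (by have := inv_le_one_of_one_le₀ hlu; linarith) (by ring)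
  rwa [smul_zero, add_zero, smul_smul, inv_mul_cancel₀ (by positivity), one_smul] at this

theorem dist_smul_affine_le {E : Type*} [NormedAddCommGroup E] [InnerProductSpace ℝ E]
    {f : ℝ → E} (hf : LipschitzWith 1 f) {M : ℝ} (hM : ∀ u, ‖f u‖ ≤ M) {α β u v : ℝ}
    (huv : u ≤ v) (hu : 1 ≤ α + β * u) (hv : 1 ≤ α + β * v) :
    dist ((α + β * u) • f u) ((α + β * v) • f v) ≤
      (α * v + β * v ^ 2 / 2 + β * ‖f v‖ ^ 2 / 2 + β ^ 2 * M ^ 2 * v) -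
      (α * u + β * u ^ 2 / 2 + β * ‖f u‖ ^ 2 / 2 + β ^ 2 * M ^ 2 * u) := by
  have hM0 : 0 ≤ M := (norm_nonneg _).trans (hM 0)
  set δ := v - u with hδ
  have hδ0 : 0 ≤ δ := sub_nonneg.2 huv
  set lb := α + β * ((u + v) / 2) with hlb
  have hlb1 : 1 ≤ lb := by rw [hlb]; linarith
  set D := f v - f u with hD
  set F := (1 / 2 : ℝ) • (f u + f v) with hF
  have hDδ : ‖D‖ ≤ δ := by
    have := hf.dist_le_mul v u
    rw [NNReal.coe_one, one_mul, dist_eq_norm, Real.dist_eq, abs_of_nonneg hδ0] at this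
    exact this
  have hFM : ‖F‖ ≤ M := by
    rw [hF, norm_smul]
    have := norm_add_le (f u) (f v)
    have h1 := hM u
    have h2 := hM v
    norm_num
    linarith
  have hDF : inner ℝ D F = (‖f v‖ ^ 2 - ‖f u‖ ^ 2) / 2 := by
    rw [hD, hF, inner_smul_right, inner_sub_left, inner_add_right, inner_add_right,
      real_inner_self_eq_norm_sq, real_inner_self_eq_norm_sq, real_inner_comm]
    ring
  have hexp : (α + β * v) • f v - (α + β * u) • f u = lb • D + (β * δ) • F := by
    rw [hD, hF, hlb, hδ]
    module
  have hsq : ‖(α + β * v) • f v - (α + β * u) • f u‖ ^ 2 ≤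
      (lb * δ + β * (‖f v‖ ^ 2 - ‖f u‖ ^ 2) / 2 + β ^ 2 * M ^ 2 * δ) ^ 2 := by
    rw [hexp, norm_add_sq_real, norm_smul, norm_smul, inner_smul_left, inner_smul_right, hDF]
    simp only [mul_pow, Real.norm_eq_abs, sq_abs, conj_trivial]
    have h1 : ‖D‖ ^ 2 ≤ δ ^ 2 := by gcongr
    have h2 : ‖F‖ ^ 2 ≤ M ^ 2 := by gcongr
    set Δ := ‖f v‖ ^ 2 - ‖f u‖ ^ 2
    have h3 : 0 ≤ (lb ^ 2) * (δ ^ 2 - ‖D‖ ^ 2) := mul_nonneg (sq_nonneg _) (by linarith)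
    have h4 : 0 ≤ (β ^ 2 * δ ^ 2) * (M ^ 2 - ‖F‖ ^ 2) := mul_nonneg (by positivity) (by linarith)
    have h5 : 0 ≤ (lb - 1) * (β ^ 2 * M ^ 2 * δ ^ 2) := mul_nonneg (by linarith) (by positivity)
    have h6 : 0 ≤ β ^ 2 * M ^ 2 * δ ^ 2 := by positivity
    nlinarith [sq_nonneg (β * Δ / 2 + β ^ 2 * M ^ 2 * δ)]
  have hpos : 0 ≤ lb * δ + β * (‖f v‖ ^ 2 - ‖f u‖ ^ 2) / 2 + β ^ 2 * M ^ 2 * δ := by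
    have h1 : |(‖f v‖ ^ 2 - ‖f u‖ ^ 2) / 2| ≤ δ * M := by
      rw [← hDF]
      exact (abs_real_inner_le_norm _ _).trans (mul_le_mul hDδ hFM (norm_nonneg _) hδ0)
    have h2 : |β * ((‖f v‖ ^ 2 - ‖f u‖ ^ 2) / 2)| ≤ |β| * (δ * M) := by
      rw [abs_mul]; gcongr
    have h3 := (abs_le.1 h2).1
    have h4 : |β| ^ 2 = β ^ 2 := sq_abs β
    rw [← h4]
    nlinarith [mul_nonneg hδ0 (sq_nonneg (|β| * M - 1)), mul_nonneg hδ0 (sub_nonneg.2 hlb1),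
      mul_nonneg hδ0 (mul_nonneg (abs_nonneg β) hM0)]
  rw [dist_comm, dist_eq_norm]
  refine (abs_le_of_sq_le_sq' hsq hpos).2.trans (le_of_eq ?_)
  rw [hlb, hδ]; ring

theorem liftCurve_lipschitz {L : ℝ} {γ : AddCircle L → E3} (hγ : IsInspectionCurve L γ) :
    LipschitzWith 1 (liftCurve L γ) := hγ.2.2.1

theorem liftCurve_periodic (L : ℝ) (γ : AddCircle L → E3) :
    Function.Periodic (liftCurve L γ) L := fun x => by simp [liftCurve]

theorem liftCurve_image_Icc {L : ℝ} (hL : 0 < L) (γ : AddCircle L → E3) (A : ℝ) :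
    liftCurve L γ '' Icc A (A + L) = range γ := by
  have : Fact (0 < L) := ⟨hL⟩
  apply Subset.antisymm
  · rintro _ ⟨x, -, rfl⟩; exact ⟨_, rfl⟩
  · rintro _ ⟨x, rfl⟩
    obtain ⟨y, hy, rfl⟩ : x ∈ ((↑) : ℝ → AddCircle L) '' Icc A (A + L) := by
      rw [AddCircle.coe_image_Icc_eq]; trivial
    exact ⟨y, hy, rfl⟩

theorem exists_norm_liftCurve_le {L : ℝ} {γ : AddCircle L → E3} (hγ : IsInspectionCurve L γ) :
    ∃ M, ∀ u, ‖liftCurve L γ u‖ ≤ M := by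
  have : Fact (0 < L) := ⟨hγ.1⟩
  obtain ⟨M, hM⟩ := (isCompact_range hγ.2.1).isBounded.exists_norm_le
  exact ⟨M, fun u => hM _ ⟨_, rfl⟩⟩

theorem zero_mem_convexHull_of_sphere_subset {S : Set E3}
    (h : Metric.sphere (0 : E3) 1 ⊆ convexHull ℝ S) : (0 : E3) ∈ convexHull ℝ S := by
  have h1 : (EuclideanSpace.single 0 1 : E3) ∈ convexHull ℝ S := h (by simp)
  have h2 : -(EuclideanSpace.single 0 1 : E3) ∈ convexHull ℝ S := h (by simp)
  have := convex_convexHull ℝ S h1 h2 (a := 1 / 2) (b := 1 / 2) (by norm_num) (by norm_num)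
    (by norm_num)
  simpa using this

theorem IsMinInspectionCurve.slope_normSq_le {L : ℝ} {γ : AddCircle L → E3}
    (hγ : IsMinInspectionCurve L γ) {m a b : ℝ} (ha : 0 < a) (hb : 0 < b) (hab : a + b ≤ L) :
    (‖liftCurve L γ (m + b)‖ ^ 2 - ‖liftCurve L γ m‖ ^ 2) / b -
      (‖liftCurve L γ m‖ ^ 2 - ‖liftCurve L γ (m - a)‖ ^ 2) / a ≤ a + b := by
  have hL := hγ.1.1
  set f := liftCurve L γ with hf
  have hlip : LipschitzWith 1 f := liftCurve_lipschitz hγ.1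
  have hper : Function.Periodic f L := liftCurve_periodic L γ
  obtain ⟨M, hM⟩ := exists_norm_liftCurve_le hγ.1
  rw [← hf] at hM
  have hM0 : 0 ≤ M := (norm_nonneg _).trans (hM 0)
  set T := (‖f (m + b)‖ ^ 2 - ‖f m‖ ^ 2) / b - (‖f m‖ ^ 2 - ‖f (m - a)‖ ^ 2) / a with hT
  have key : ∀ ε : ℝ, 0 < ε → T ≤ a + b + ε * (2 * M ^ 2 * (1 / a + 1 / b)) := by
    intro ε hε
    set l : ℝ → ℝ := fun u => 1 + ε * max 0 (min ((u - (m - a)) / a) ((m + b - u) / b)) with hl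
    have hl1 : ∀ u, 1 ≤ l u := fun u => by
      have : 0 ≤ ε * max 0 (min ((u - (m - a)) / a) ((m + b - u) / b)) := by positivity
      simp only [hl]; linarith
    have hp1 : ∀ u ∈ Icc (m - a) m, l u = (1 - ε / a * (m - a)) + ε / a * u := by
      intro u hu
      have e1 : (u - (m - a)) / a ≤ 1 := by rw [div_le_one ha]; linarith [hu.2]
      have e2 : 1 ≤ (m + b - u) / b := by rw [le_div_iff₀ hb]; linarith [hu.2]
      have e3 : 0 ≤ (u - (m - a)) / a := div_nonneg (by linarith [hu.1]) ha.le
      simp only [hl]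
      rw [min_eq_left (e1.trans e2), max_eq_right e3]; ring
    have hp2 : ∀ u ∈ Icc m (m + b), l u = (1 + ε / b * (m + b)) + (-(ε / b)) * u := by
      intro u hu
      have e1 : 1 ≤ (u - (m - a)) / a := by rw [le_div_iff₀ ha]; linarith [hu.1]
      have e2 : (m + b - u) / b ≤ 1 := by rw [div_le_one hb]; linarith [hu.1]
      have e3 : 0 ≤ (m + b - u) / b := div_nonneg (by linarith [hu.2]) hb.le
      simp only [hl]
      rw [min_eq_right (e2.trans e1), max_eq_right e3]; ring
    have hp3 : ∀ u ∈ Icc (m + b) (m - a + L), l u = 1 + 0 * u := by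
      intro u hu
      have e3 : (m + b - u) / b ≤ 0 := div_nonpos_of_nonpos_of_nonneg (by linarith [hu.1]) hb.le
      simp only [hl]
      rw [max_eq_left ((min_le_right _ _).trans e3)]; ring
    set g : ℝ → E3 := fun u => l u • f u with hg
    have hpiece : ∀ (p q α β : ℝ), p ≤ q → (∀ u ∈ Icc p q, l u = α + β * u) →
        eVariationOn g (Icc p q) ≤ ENNReal.ofReal
          ((α * q + β * q ^ 2 / 2 + β * ‖f q‖ ^ 2 / 2 + β ^ 2 * M ^ 2 * q) -
          (α * p + β * p ^ 2 / 2 + β * ‖f p‖ ^ 2 / 2 + β ^ 2 * M ^ 2 * p)) ∧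
        0 ≤ (α * q + β * q ^ 2 / 2 + β * ‖f q‖ ^ 2 / 2 + β ^ 2 * M ^ 2 * q) -
          (α * p + β * p ^ 2 / 2 + β * ‖f p‖ ^ 2 / 2 + β ^ 2 * M ^ 2 * p) := by
      intro p q α β hpq hlin
      have hd : ∀ u ∈ Icc p q, ∀ v ∈ Icc p q, u ≤ v → dist (g u) (g v) ≤
          (α * v + β * v ^ 2 / 2 + β * ‖f v‖ ^ 2 / 2 + β ^ 2 * M ^ 2 * v) -
          (α * u + β * u ^ 2 / 2 + β * ‖f u‖ ^ 2 / 2 + β ^ 2 * M ^ 2 * u) := by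
        intro u hu v hv huv
        simp only [hg]
        have h1 := hl1 u
        have h2 := hl1 v
        rw [hlin u hu] at h1 ⊢
        rw [hlin v hv] at h2 ⊢
        exact dist_smul_affine_le hlip hM huv h1 h2
      exact ⟨eVariationOn_le_of_dist_le hpq hd, dist_nonneg.trans
        (hd p (left_mem_Icc.2 hpq) q (right_mem_Icc.2 hpq) hpq)⟩
    obtain ⟨v1, w1⟩ := hpiece _ _ _ _ (by linarith) hp1
    obtain ⟨v2, w2⟩ := hpiece _ _ _ _ (by linarith) hp2
    obtain ⟨v3, w3⟩ := hpiece _ _ _ _ (by linarith) hp3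
    have hglip : ∃ K, LipschitzOnWith K g (Icc (m - a) (m - a + L)) := by
      have hφ : LipschitzWith (1 / a + 1 / b).toNNReal
          (fun u : ℝ => min ((u - (m - a)) / a) ((m + b - u) / b)) := by
        have q1 : LipschitzWith (1 / a).toNNReal (fun u : ℝ => (u - (m - a)) / a) := by
          refine LipschitzWith.of_dist_le_mul fun u v => ?_
          rw [Real.coe_toNNReal _ (by positivity), Real.dist_eq, Real.dist_eq,
            show (u - (m - a)) / a - (v - (m - a)) / a = 1 / a * (u - v) by ring, abs_mul,
            abs_of_pos (by positivity : 0 < 1 / a)]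
        have q2 : LipschitzWith (1 / b).toNNReal (fun u : ℝ => (m + b - u) / b) := by
          refine LipschitzWith.of_dist_le_mul fun u v => ?_
          rw [Real.coe_toNNReal _ (by positivity), Real.dist_eq, Real.dist_eq,
            show (m + b - u) / b - (m + b - v) / b = 1 / b * (v - u) by ring, abs_mul,
            abs_of_pos (by positivity : 0 < 1 / b), abs_sub_comm]
        refine (q1.min q2).weaken (max_le ?_ ?_) <;> apply Real.toNNReal_le_toNNReal
        · have : 0 < 1 / b := by positivity
          linarith
        · have : 0 < 1 / a := by positivity
          linarith
      have hφ2 := hφ.const_max 0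
      refine ⟨(ε * (1 / a + 1 / b) * M + (1 + ε)).toNNReal,
        LipschitzOnWith.of_dist_le_mul fun u _ v _ => ?_⟩
      have hab0 : 0 < 1 / a + 1 / b := by positivity
      rw [Real.coe_toNNReal _ (by positivity)]
      have d1 := hφ2.dist_le_mul u v
      rw [Real.coe_toNNReal _ hab0.le] at d1
      have d2 := hlip.dist_le_mul u v
      rw [NNReal.coe_one, one_mul] at d2
      have d3 : |l v| ≤ 1 + ε := by
        rw [abs_of_nonneg (by linarith [hl1 v])]
        simp only [hl]
        have : max 0 (min ((v - (m - a)) / a) ((m + b - v) / b)) ≤ 1 := by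
          refine max_le zero_le_one ?_
          rcases le_total v m with h | h
          · exact (min_le_left _ _).trans (by rw [div_le_one ha]; linarith)
          · exact (min_le_right _ _).trans (by rw [div_le_one hb]; linarith)
        nlinarith
      have d4 : |l u - l v| ≤ ε * ((1 / a + 1 / b) * dist u v) := by
        have : l u - l v = ε * (max 0 (min ((u - (m - a)) / a) ((m + b - u) / b)) -
            max 0 (min ((v - (m - a)) / a) ((m + b - v) / b))) := by simp only [hl]; ring
        rw [this, abs_mul, abs_of_pos hε]
        rw [Real.dist_eq] at d1
        gcongr
      rw [dist_eq_norm, show g u - g v = (l u - l v) • f u + l v • (f u - f v) by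
        simp only [hg]; module]
      refine (norm_add_le _ _).trans ?_
      rw [norm_smul, norm_smul, Real.norm_eq_abs, Real.norm_eq_abs]
      rw [dist_eq_norm (f u)] at d2
      have e1 := mul_le_mul d4 (hM u) (norm_nonneg _) (by positivity)
      have e2 := mul_le_mul d3 d2 (norm_nonneg _) (by positivity)
      calc _ ≤ _ := add_le_add e1 e2
        _ = _ := by ring
    obtain ⟨K, hK⟩ := hglip
    have hclosed : g (m - a) = g (m - a + L) := by
      simp only [hg]
      rw [hp1 _ ⟨le_rfl, by linarith⟩, hp3 (m - a + L) ⟨by linarith, le_rfl⟩, hper]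
      congr 1; ring
    have hhull : Metric.sphere (0 : E3) 1 ⊆ convexHull ℝ (g '' Icc (m - a) (m - a + L)) := by
      have h1 := hγ.1.2.2.2.2
      rw [← liftCurve_image_Icc hL γ (m - a)] at h1
      exact h1.trans (convexHull_image_subset_of_one_le (fun u _ => hl1 u)
        (zero_mem_convexHull_of_sphere_subset h1))
    have hlen := hγ.le_of_closed_curve (by linarith) hK hclosed hhull
    have hvar : eVariationOn g (Icc (m - a) (m - a + L)) = eVariationOn g (Icc (m - a) m) +
        eVariationOn g (Icc m (m + b)) + eVariationOn g (Icc (m + b) (m - a + L)) := by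
      have s1 := eVariationOn.Icc_add_Icc (s := univ) g (show m - a ≤ m by linarith)
        (show m ≤ m + b by linarith) (mem_univ _)
      have s2 := eVariationOn.Icc_add_Icc (s := univ) g (show m - a ≤ m + b by linarith)
        (show m + b ≤ m - a + L by linarith) (mem_univ _)
      simp only [univ_inter] at s1 s2
      rw [s1, s2]
    have hle := add_le_add (add_le_add v1 v2) v3
    rw [← hvar, ← ENNReal.ofReal_add w1 w2, ← ENNReal.ofReal_add (add_nonneg w1 w2) w3] at hle
    have h3 := ENNReal.toReal_mono ENNReal.ofReal_ne_top hle
    rw [ENNReal.toReal_ofReal (add_nonneg (add_nonneg w1 w2) w3)] at h3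
    have h4 := hlen.trans h3
    have h5 : ε / 2 * T ≤ ε / 2 * (a + b + ε * (2 * M ^ 2 * (1 / a + 1 / b))) := by
      refine sub_nonneg.1 ((sub_nonneg.2 h4).trans_eq ?_)
      rw [hT]
      have : a ≠ 0 := ha.ne'
      have : b ≠ 0 := hb.ne'
      field_simp
      ring
    exact le_of_mul_le_mul_left h5 (by positivity)
  have hlim : Filter.Tendsto (fun ε : ℝ => a + b + ε * (2 * M ^ 2 * (1 / a + 1 / b)))
      (nhdsWithin 0 (Ioi 0)) (nhds (a + b + 0 * (2 * M ^ 2 * (1 / a + 1 / b)))) := by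
    refine Filter.Tendsto.mono_left (Continuous.tendsto (by fun_prop) 0) nhdsWithin_le_nhds
  rw [zero_mul, add_zero] at hlim
  exact ge_of_tendsto hlim (Filter.eventually_of_mem self_mem_nhdsWithin fun ε hε => key ε hε)

theorem lintegral_eq_lintegral_orthonormalBasis (b : OrthonormalBasis (Fin 3) ℝ E3)
    {F : ℝ × ℝ × ℝ → ℝ≥0∞} (hF : Measurable F) :
    ∫⁻ q : E3, F (b.repr q 0, b.repr q 1, b.repr q 2) = ∫⁻ p : ℝ × ℝ × ℝ, F p := by
  have h1 := b.measurePreserving_repr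
  have h2 := PiLp.volume_preserving_ofLp (Fin 3)
  have h3 := volume_preserving_piFinSuccAbove (fun _ : Fin 3 => ℝ) 0
  have h4 := volume_preserving_finTwoArrow ℝ
  have h5 := (MeasurePreserving.id (volume : Measure ℝ)).prod h4
  have h6 := h5.comp (h3.comp (h2.comp h1))
  exact h6.lintegral_comp hF

theorem lintegral_polar (G : ℝ × ℝ → ℝ≥0∞) (hG : Measurable G) :
    ∫⁻ p : ℝ × ℝ, G p = ∫⁻ r in Ioi (0 : ℝ), ∫⁻ φ in Ioo (-π) π,
      ENNReal.ofReal r * G (r * cos φ, r * sin φ) := by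
  rw [← lintegral_comp_polarCoord_symm, polarCoord_target, Measure.volume_eq_prod,
    ← Measure.prod_restrict, lintegral_prod]
  · rfl
  · have : Measurable (fun p : ℝ × ℝ => ENNReal.ofReal p.1 * G (p.1 * cos p.2, p.1 * sin p.2)) :=
      by fun_prop
    exact this.aemeasurable

theorem lintegral_spherical (b : OrthonormalBasis (Fin 3) ℝ E3)
    {F : ℝ × ℝ × ℝ → ℝ≥0∞} (hF : Measurable F) :
    ∫⁻ q : E3, F (b.repr q 0, b.repr q 1, b.repr q 2) =
      ∫⁻ r in Ioi (0 : ℝ), ∫⁻ θ in Ioo 0 π, ∫⁻ φ in Ioo (-π) π,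
        ENNReal.ofReal (r ^ 2 * sin θ) *
          F (r * cos θ, r * sin θ * cos φ, r * sin θ * sin φ) := by
  rw [lintegral_eq_lintegral_orthonormalBasis b hF, Measure.volume_eq_prod,
    lintegral_prod _ hF.aemeasurable]
  have step : ∀ x : ℝ, ∫⁻ p : ℝ × ℝ, F (x, p) = ∫⁻ s : ℝ, (Ioi (0 : ℝ)).indicator (fun s =>
      ∫⁻ φ in Ioo (-π) π, ENNReal.ofReal s * F (x, s * cos φ, s * sin φ)) s := by
    intro x
    rw [lintegral_polar (fun p => F (x, p)) (by fun_prop), lintegral_indicator measurableSet_Ioi]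
  simp_rw [step]
  set H : ℝ × ℝ → ℝ≥0∞ := fun p => (Ioi (0 : ℝ)).indicator (fun s =>
      ∫⁻ φ in Ioo (-π) π, ENNReal.ofReal s * F (p.1, s * cos φ, s * sin φ)) p.2 with hH
  have hHm : Measurable H := by
    have h1 : Measurable (fun p : ℝ × ℝ =>
        ∫⁻ φ in Ioo (-π) π, ENNReal.ofReal p.2 * F (p.1, p.2 * cos φ, p.2 * sin φ)) := by
      apply Measurable.lintegral_prod_right'
        (f := fun z : (ℝ × ℝ) × ℝ =>
          ENNReal.ofReal z.1.2 * F (z.1.1, z.1.2 * cos z.2, z.1.2 * sin z.2))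
      fun_prop
    exact h1.indicator (measurable_snd measurableSet_Ioi)
  have h2 : ∫⁻ x : ℝ, ∫⁻ s : ℝ, H (x, s) = ∫⁻ p : ℝ × ℝ, H p := by
    rw [Measure.volume_eq_prod, lintegral_prod _ hHm.aemeasurable]
  refine h2.trans ?_
  rw [lintegral_polar H hHm]
  refine setLIntegral_congr_fun measurableSet_Ioi fun r hr => ?_
  have hr : 0 < r := hr
  have hsub : Ioo 0 π ⊆ Ioo (-π) π := Ioo_subset_Ioo_left (by linarith [pi_pos])
  rw [← inter_eq_left.2 hsub, ← setLIntegral_indicator measurableSet_Ioo]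
  refine setLIntegral_congr_fun measurableSet_Ioo fun θ hθ => ?_
  by_cases h : 0 < θ
  · have hs : 0 < sin θ := sin_pos_of_pos_of_lt_pi h hθ.2
    have hmem : θ ∈ Ioo 0 π := ⟨h, hθ.2⟩
    simp only [hH]
    rw [indicator_of_mem hmem, indicator_of_mem (show r * sin θ ∈ Ioi (0 : ℝ) from
      mul_pos hr hs), ← lintegral_const_mul' _ _ ENNReal.ofReal_ne_top]
    refine lintegral_congr fun φ => ?_
    rw [← mul_assoc, ← ENNReal.ofReal_mul hr.le]
    congr 2
    ring
  · have hmem : θ ∉ Ioo 0 π := fun h' => h h'.1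
    have hs : sin θ ≤ 0 := sin_nonpos_of_nonpos_of_neg_pi_le (not_lt.1 h) hθ.1.le
    simp only [hH]
    rw [indicator_of_notMem hmem, indicator_of_notMem (show r * sin θ ∉ Ioi (0 : ℝ) from
      fun h' => (mul_nonpos_of_nonneg_of_nonpos hr.le hs).not_gt h'), mul_zero]

open InnerProductSpace in
theorem exists_orthonormalBasis_adapted (x v : E3) (hx : x ≠ 0) :
    ∃ b : OrthonormalBasis (Fin 3) ℝ E3, ∃ α β : ℝ, x = ‖x‖ • b 0 ∧ v = α • b 0 + β • b 1 := by
  set f : Fin 3 → E3 := ![x, v, 0]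
  set b := gramSchmidtOrthonormalBasis (𝕜 := ℝ) (ι := Fin 3) (E := E3) (by simp) f with hb
  have h01 : b.repr x 1 = 0 :=
    gramSchmidtOrthonormalBasis_inv_triangular' (by simp) f (i := 0) (j := 1) (by decide)
  have h02 : b.repr x 2 = 0 :=
    gramSchmidtOrthonormalBasis_inv_triangular' (by simp) f (i := 0) (j := 2) (by decide)
  have h12 : b.repr v 2 = 0 :=
    gramSchmidtOrthonormalBasis_inv_triangular' (by simp) f (i := 1) (j := 2) (by decide)
  have hb0 : b 0 = ‖x‖⁻¹ • x := by
    have h : gramSchmidtNormed ℝ f 0 = ‖x‖⁻¹ • x := by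
      have : gramSchmidt ℝ f 0 = x := gramSchmidt_bot ℝ f
      rw [gramSchmidtNormed, this]; rfl
    rw [hb, gramSchmidtOrthonormalBasis_apply _ (by rw [h]; simpa using hx), h]
  refine ⟨b, b.repr v 0, b.repr v 1, ?_, ?_⟩
  · rw [hb0, smul_smul, mul_inv_cancel₀ (by simpa using hx), one_smul]
  · have := b.sum_repr v
    rw [Fin.sum_univ_three, h12, zero_smul, add_zero] at this
    exact this.symm

theorem ofReal_abs_sub_clamp_le_lintegral {φ : ℝ → ℝ} {K : NNReal} (hφ : LipschitzWith K φ)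
    {α β s t : ℝ} (hst : s ≤ t) :
    ENNReal.ofReal |max α (min β (φ t)) - max α (min β (φ s))| ≤
      ∫⁻ u in Ioc s t, (φ ⁻¹' Icc α β).indicator (fun u => ‖deriv φ u‖ₑ) u := by
  set G : ℝ → ℝ := fun u => max α (min β (φ u)) with hG
  have hGlip : LipschitzWith K G := (hφ.const_min β).const_max α
  have hac : AbsolutelyContinuousOnInterval G s t :=
    (hGlip.lipschitzOnWith (s := uIcc s t)).absolutelyContinuousOnInterval
  have h1 := hac.integral_deriv_eq_sub
  change ENNReal.ofReal |G t - G s| ≤ _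
  rw [← h1, ← Real.norm_eq_abs, ofReal_norm, intervalIntegral.integral_of_le hst]
  refine (enorm_integral_le_lintegral_enorm _).trans (lintegral_mono_ae ?_)
  refine ae_restrict_of_ae ?_
  filter_upwards [hφ.ae_differentiableAt_real, hGlip.ae_differentiableAt_real] with u hu hu'
  by_cases hm : u ∈ φ ⁻¹' Icc α β
  · rw [indicator_of_mem hm]
    rw [← ofReal_norm, ← ofReal_norm]
    refine ENNReal.ofReal_le_ofReal ?_
    have t1 := (hasDerivAt_iff_tendsto_slope.1 hu'.hasDerivAt).norm
    have t2 := (hasDerivAt_iff_tendsto_slope.1 hu.hasDerivAt).norm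
    refine le_of_tendsto_of_tendsto' t1 t2 fun w => ?_
    rw [slope_def_field, slope_def_field, norm_div, norm_div, Real.norm_eq_abs, Real.norm_eq_abs]
    refine div_le_div_of_nonneg_right ?_ (abs_nonneg _)
    have hl := ((LipschitzWith.id.const_min β).const_max α).dist_le_mul (φ w) (φ u)
    simpa [Real.dist_eq] using hl
  · rw [indicator_of_notMem hm]
    have hlc : G =ᶠ[nhds u] fun _ => G u := by
      rcases not_and_or.1 hm with h | h
      · have h' : φ u < α := not_le.1 h
        have : ∀ᶠ w in nhds u, φ w < α := hφ.continuous.continuousAt.eventually_lt_const h'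
        filter_upwards [this] with w hw
        simp only [hG]
        rw [max_eq_left ((min_le_right _ _).trans hw.le),
          max_eq_left ((min_le_right _ _).trans h'.le)]
      · have h' : β < φ u := not_le.1 h
        have : ∀ᶠ w in nhds u, β < φ w := hφ.continuous.continuousAt.eventually_const_lt h'
        filter_upwards [this] with w hw
        simp only [hG]
        rw [min_eq_left hw.le, min_eq_left h'.le]
    rw [hlc.deriv_eq]
    simp

theorem ofReal_two_mul_le_lintegral_band {φ : ℝ → ℝ} {K : NNReal} (hφ : LipschitzWith K φ)
    {L : ℝ} (hper : Function.Periodic φ L) {α β s t₁ t₂ : ℝ} (hαβ : α ≤ β)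
    (h₁ : t₁ ∈ Icc s (s + L)) (h₂ : t₂ ∈ Icc s (s + L)) (hβ : β ≤ φ t₁) (hα : φ t₂ ≤ α) :
    ENNReal.ofReal (2 * (β - α)) ≤
      ∫⁻ u in Ioc s (s + L), (φ ⁻¹' Icc α β).indicator (fun u => ‖deriv φ u‖ₑ) u := by
  set G : ℝ → ℝ := fun u => max α (min β (φ u)) with hG
  have hG1 : G t₁ = β := by simp only [hG]; rw [min_eq_left hβ, max_eq_right hαβ]
  have hG2 : G t₂ = α := by
    simp only [hG]; rw [min_eq_right (hα.trans hαβ), max_eq_left hα]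
  have hGper : G (s + L) = G s := by simp only [hG]; rw [hper]
  have key : ∀ p q, p ∈ Icc s (s + L) → q ∈ Icc s (s + L) → p ≤ q → |G p - G q| = β - α →
      ENNReal.ofReal (2 * (β - α)) ≤
      ∫⁻ u in Ioc s (s + L), (φ ⁻¹' Icc α β).indicator (fun u => ‖deriv φ u‖ₑ) u := by
    intro p q hp hq hpq hval
    have i1 := ofReal_abs_sub_clamp_le_lintegral hφ (α := α) (β := β) hp.1
    have i2 := ofReal_abs_sub_clamp_le_lintegral hφ (α := α) (β := β) hpq
    have i3 := ofReal_abs_sub_clamp_le_lintegral hφ (α := α) (β := β) hq.2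
    have hsum := add_le_add (add_le_add i1 i2) i3
    rw [← lintegral_union measurableSet_Ioc (Ioc_disjoint_Ioc_of_le le_rfl),
      Ioc_union_Ioc_eq_Ioc hp.1 hpq,
      ← lintegral_union measurableSet_Ioc (Ioc_disjoint_Ioc_of_le le_rfl),
      Ioc_union_Ioc_eq_Ioc (hp.1.trans hpq) hq.2] at hsum
    refine le_trans ?_ hsum
    rw [← ENNReal.ofReal_add (abs_nonneg _) (abs_nonneg _),
      ← ENNReal.ofReal_add (by positivity) (abs_nonneg _)]
    refine ENNReal.ofReal_le_ofReal ?_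
    change _ ≤ |G p - G s| + |G q - G p| + |G (s + L) - G q|
    rw [hGper]
    have := abs_sub_le (G p) (G s) (G q)
    rw [abs_sub_comm (G q)]
    linarith
  rcases le_total t₁ t₂ with h | h
  · exact key _ _ h₁ h₂ h (by rw [hG1, hG2, abs_of_nonneg (by linarith)])
  · exact key _ _ h₂ h₁ h (by rw [hG1, hG2, abs_sub_comm, abs_of_nonneg (by linarith)])

theorem exists_norm_le_inner_liftCurve {L : ℝ} {γ : AddCircle L → E3}
    (hγ : IsInspectionCurve L γ) (s : ℝ) (q : E3) :
    ∃ t ∈ Icc s (s + L), ‖q‖ ≤ inner ℝ (liftCurve L γ t) q := by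
  have hL := hγ.1
  rcases eq_or_ne q 0 with rfl | hq
  · exact ⟨s, ⟨le_rfl, by linarith⟩, by simp⟩
  by_contra! hcon
  have hhull := hγ.2.2.2.2
  rw [← liftCurve_image_Icc hL γ s] at hhull
  have hq0 : 0 < ‖q‖ := norm_pos_iff.2 hq
  have hmem : (‖q‖⁻¹ • q) ∈ Metric.sphere (0 : E3) 1 := by
    simp [norm_smul, hq0.ne']
  have hconv : Convex ℝ {x : E3 | inner ℝ x q < ‖q‖} := by
    refine convex_halfSpace_lt ⟨fun x y => inner_add_left x y q, fun c x => ?_⟩ _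
    simp [inner_smul_left]
  have h1 : (‖q‖⁻¹ • q) ∈ {x : E3 | inner ℝ x q < ‖q‖} := by
    refine convexHull_min ?_ hconv (hhull hmem)
    rintro _ ⟨t, ht, rfl⟩
    exact hcon t ht
  simp only [mem_ofPred_eq, inner_smul_left, real_inner_self_eq_norm_sq, conj_trivial] at h1
  rw [sq, inv_mul_cancel_left₀ hq0.ne'] at h1
  exact lt_irrefl _ h1

/-- The contribution of a point `x`, moving with velocity `v`, to the number of intersections of
a curve with planes whose distance from the origin lies between `1 - ε` and `1`. -/
def bandSpeed (ε : ℝ) (x v q : E3) : ℝ≥0∞ :=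
  {q : E3 | (1 - ε) * ‖q‖ ≤ inner ℝ x q ∧ inner ℝ x q ≤ ‖q‖}.indicator
    (fun q => ‖inner ℝ v q‖ₑ) q

theorem ofReal_two_mul_le_lintegral_bandSpeed {L : ℝ} {γ : AddCircle L → E3}
    (hγ : IsInspectionCurve L γ) (s : ℝ) {ε : ℝ} (hε : 0 ≤ ε) (hε1 : ε ≤ 1) (q : E3) :
    ENNReal.ofReal (2 * ε * ‖q‖) ≤
      ∫⁻ t in Ioc s (s + L), bandSpeed ε (liftCurve L γ t) (deriv (liftCurve L γ) t) q := by
  set f := liftCurve L γ with hf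
  obtain ⟨t₁, h₁, hb₁⟩ := exists_norm_le_inner_liftCurve hγ s q
  obtain ⟨t₂, h₂, hb₂⟩ := exists_norm_le_inner_liftCurve hγ s (-q)
  rw [norm_neg, inner_neg_right] at hb₂
  have hflip : LipschitzWith 1 f := liftCurve_lipschitz hγ
  have hlip : LipschitzWith ‖q‖₊ (fun t => inner ℝ (f t) q) := by
    refine LipschitzWith.of_dist_le_mul fun u v => ?_
    rw [Real.dist_eq, ← inner_sub_left, coe_nnnorm]
    refine (abs_real_inner_le_norm _ _).trans ?_
    rw [mul_comm, ← dist_eq_norm]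
    have := hflip.dist_le_mul u v
    rw [NNReal.coe_one, one_mul] at this
    gcongr
  have hper : Function.Periodic (fun t => inner ℝ (f t) q) L := fun t => by
    simp only [hf, liftCurve_periodic L γ t]
  have hq0 := norm_nonneg q
  have := ofReal_two_mul_le_lintegral_band hlip hper (α := (1 - ε) * ‖q‖) (β := ‖q‖)
    (by nlinarith) h₁ h₂ hb₁ (by nlinarith)
  rw [show 2 * (‖q‖ - (1 - ε) * ‖q‖) = 2 * ε * ‖q‖ by ring] at this
  refine this.trans (lintegral_mono_ae (ae_restrict_of_ae ?_))
  filter_upwards [hflip.ae_differentiableAt] with t ht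
  have hd : deriv (fun t => inner ℝ (f t) q) t = inner ℝ (deriv f t) q := by
    have := ht.hasDerivAt.inner ℝ (hasDerivAt_const t q)
    simpa using this.deriv
  rw [bandSpeed]
  simp only [indicator, mem_preimage, mem_Icc, mem_ofPred_eq, hd]
  exact le_rfl

theorem measurable_bandSpeed {ε : ℝ} {f f' : ℝ → E3} (hf : Measurable f) (hf' : Measurable f') :
    Measurable (fun z : E3 × ℝ => bandSpeed ε (f z.2) (f' z.2) z.1) := by
  have h1 : Measurable (fun z : E3 × ℝ => inner ℝ (f z.2) z.1) := by fun_prop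
  have h2 : Measurable (fun z : E3 × ℝ => ‖inner ℝ (f' z.2) z.1‖ₑ) := by fun_prop
  have h3 : MeasurableSet {z : E3 × ℝ | (1 - ε) * ‖z.1‖ ≤ inner ℝ (f z.2) z.1 ∧
      inner ℝ (f z.2) z.1 ≤ ‖z.1‖} :=
    (measurableSet_le (by fun_prop) h1).inter (measurableSet_le h1 (by fun_prop))
  exact h2.indicator h3

theorem lintegral_norm_ball_le_lintegral_bandSpeed {L : ℝ} {γ : AddCircle L → E3}
    (hγ : IsInspectionCurve L γ) (s : ℝ) {ε : ℝ} (hε : 0 ≤ ε) (hε1 : ε ≤ 1) :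
    ∫⁻ q in Metric.ball (0 : E3) 1, ENNReal.ofReal (2 * ε * ‖q‖) ≤
      ∫⁻ t in Ioc s (s + L), ∫⁻ q in Metric.ball (0 : E3) 1,
        bandSpeed ε (liftCurve L γ t) (deriv (liftCurve L γ) t) q := by
  refine (lintegral_mono fun q =>
    ofReal_two_mul_le_lintegral_bandSpeed hγ s hε hε1 q).trans (le_of_eq ?_)
  have hf : Measurable (liftCurve L γ) := (liftCurve_lipschitz hγ).continuous.measurable
  have hf' : Measurable (deriv (liftCurve L γ)) := measurable_deriv _
  generalize deriv (liftCurve L γ) = f' at hf' ⊢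
  generalize liftCurve L γ = f at hf ⊢
  exact lintegral_lintegral_swap (measurable_bandSpeed hf hf').aemeasurable

theorem lintegral_ball_of_homogeneous (b : OrthonormalBasis (Fin 3) ℝ E3)
    {Φ : ℝ × ℝ × ℝ → ℝ≥0∞} (hΦ : Measurable Φ)
    (hom : ∀ r > 0, ∀ x y z, Φ (r * x, r * y, r * z) = ENNReal.ofReal r * Φ (x, y, z)) :
    ∫⁻ q in Metric.ball (0 : E3) 1, Φ (b.repr q 0, b.repr q 1, b.repr q 2) =
      ENNReal.ofReal (1 / 4) * ∫⁻ θ in Ioo 0 π, ENNReal.ofReal (sin θ) *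
        ∫⁻ φ in Ioo (-π) π, Φ (cos θ, sin θ * cos φ, sin θ * sin φ) := by
  set S : Set (ℝ × ℝ × ℝ) := {p | p.1 ^ 2 + p.2.1 ^ 2 + p.2.2 ^ 2 < 1} with hS
  have hSm : MeasurableSet S := measurableSet_lt (by fun_prop) (by fun_prop)
  have hmem : ∀ q : E3, q ∈ Metric.ball (0 : E3) 1 ↔
      (b.repr q 0, b.repr q 1, b.repr q 2) ∈ S := fun q => by
    rw [mem_ball_zero_iff, ← b.repr.norm_map, EuclideanSpace.norm_eq, hS]
    simp only [mem_ofPred_eq, Fin.sum_univ_three, Real.norm_eq_abs, sq_abs]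
    rw [Real.sqrt_lt' one_pos, one_pow]
  rw [← lintegral_indicator Metric.isOpen_ball.measurableSet]
  have h1 : ∀ q : E3, (Metric.ball (0 : E3) 1).indicator
      (fun q => Φ (b.repr q 0, b.repr q 1, b.repr q 2)) q =
      S.indicator Φ (b.repr q 0, b.repr q 1, b.repr q 2) := fun q => by
    by_cases hq : q ∈ Metric.ball (0 : E3) 1
    · rw [indicator_of_mem hq, indicator_of_mem ((hmem q).1 hq)]
    · rw [indicator_of_notMem hq, indicator_of_notMem (fun h => hq ((hmem q).2 h))]
  simp_rw [h1]
  rw [lintegral_spherical b (hΦ.indicator hSm)]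
  set W := ∫⁻ θ in Ioo 0 π, ENNReal.ofReal (sin θ) *
        ∫⁻ φ in Ioo (-π) π, Φ (cos θ, sin θ * cos φ, sin θ * sin φ) with hW
  have h2 : ∀ r ∈ Ioi (0 : ℝ), (∫⁻ θ in Ioo 0 π, ∫⁻ φ in Ioo (-π) π,
      ENNReal.ofReal (r ^ 2 * sin θ) *
        S.indicator Φ (r * cos θ, r * sin θ * cos φ, r * sin θ * sin φ)) =
      (Iio (1 : ℝ)).indicator (fun r => ENNReal.ofReal (r ^ 3) * W) r := by
    intro r hr
    have hr : 0 < r := hr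
    have hiff : ∀ θ φ, (r * cos θ, r * sin θ * cos φ, r * sin θ * sin φ) ∈ S ↔ r ∈ Iio (1 : ℝ) := by
      intro θ φ
      simp only [hS, mem_ofPred_eq, mem_Iio]
      have e : (r * cos θ) ^ 2 + (r * sin θ * cos φ) ^ 2 + (r * sin θ * sin φ) ^ 2 = r ^ 2 := by
        linear_combination r ^ 2 * sin θ ^ 2 * sin_sq_add_cos_sq φ + r ^ 2 * sin_sq_add_cos_sq θ
      rw [e, sq_lt_one_iff₀ hr.le]
    by_cases hr1 : r ∈ Iio (1 : ℝ)
    · rw [indicator_of_mem hr1, hW, ← lintegral_const_mul' _ _ ENNReal.ofReal_ne_top]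
      refine setLIntegral_congr_fun measurableSet_Ioo fun θ hθ => ?_
      have hs : 0 ≤ sin θ := (sin_pos_of_pos_of_lt_pi hθ.1 hθ.2).le
      rw [← lintegral_const_mul' _ _ ENNReal.ofReal_ne_top,
        ← lintegral_const_mul' _ _ ENNReal.ofReal_ne_top]
      refine lintegral_congr fun φ => ?_
      rw [indicator_of_mem ((hiff θ φ).2 hr1), mul_assoc r, mul_assoc r, hom r hr,
        ← mul_assoc, ← mul_assoc, ← ENNReal.ofReal_mul (by positivity),
        ← ENNReal.ofReal_mul (by positivity)]
      congr 2
      ring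
    · rw [indicator_of_notMem hr1]
      have : ∀ θ φ, S.indicator Φ (r * cos θ, r * sin θ * cos φ, r * sin θ * sin φ) = 0 :=
        fun θ φ => indicator_of_notMem (fun h => hr1 ((hiff θ φ).1 h)) _
      simp [this]
  rw [setLIntegral_congr_fun measurableSet_Ioi h2, lintegral_indicator measurableSet_Iio,
    Measure.restrict_restrict measurableSet_Iio, lintegral_mul_const _ (by fun_prop)]
  congr 1
  rw [Iio_inter_Ioi, ← ofReal_integral_eq_lintegral_ofReal, ← integral_Ioc_eq_integral_Ioo,
    ← intervalIntegral.integral_of_le zero_le_one]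
  · norm_num
  · exact (continuous_pow 3).continuousOn.integrableOn_Icc.mono_set Ioo_subset_Icc_self
  · filter_upwards [ae_restrict_mem measurableSet_Ioo] with r hr
    exact pow_nonneg hr.1.le 3

theorem lintegral_ball_ofReal_norm {ε : ℝ} (hε : 0 ≤ ε) :
    ∫⁻ q in Metric.ball (0 : E3) 1, ENNReal.ofReal (2 * ε * ‖q‖) =
      ENNReal.ofReal (2 * π * ε) := by
  have b : OrthonormalBasis (Fin 3) ℝ E3 := EuclideanSpace.basisFun (Fin 3) ℝ
  have h1 : ∀ q : E3, ENNReal.ofReal (2 * ε * ‖q‖) =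
      (fun p : ℝ × ℝ × ℝ => ENNReal.ofReal (2 * ε * √(p.1 ^ 2 + p.2.1 ^ 2 + p.2.2 ^ 2)))
        (b.repr q 0, b.repr q 1, b.repr q 2) := fun q => by
    rw [← b.repr.norm_map, EuclideanSpace.norm_eq]
    simp only [Fin.sum_univ_three, Real.norm_eq_abs, sq_abs]
  refine ((lintegral_congr h1).trans (lintegral_ball_of_homogeneous b
    (Φ := fun p => ENNReal.ofReal (2 * ε * √(p.1 ^ 2 + p.2.1 ^ 2 + p.2.2 ^ 2))) ?_ ?_)).trans ?_
  · fun_prop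
  · intro r hr x y z
    simp only
    rw [← ENNReal.ofReal_mul hr.le]
    congr 1
    rw [show (r * x) ^ 2 + (r * y) ^ 2 + (r * z) ^ 2 = r ^ 2 * (x ^ 2 + y ^ 2 + z ^ 2) by ring,
      Real.sqrt_mul (by positivity), Real.sqrt_sq hr.le]
    ring
  · have h2 : ∀ θ φ, (cos θ) ^ 2 + (sin θ * cos φ) ^ 2 + (sin θ * sin φ) ^ 2 = 1 := fun θ φ => by
      linear_combination sin θ ^ 2 * sin_sq_add_cos_sq φ + sin_sq_add_cos_sq θ
    simp only [h2, sqrt_one, mul_one, lintegral_const, Measure.restrict_apply_univ,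
      Real.volume_Ioo, sub_neg_eq_add]
    rw [lintegral_mul_const _ (by fun_prop), ← ofReal_integral_eq_lintegral_ofReal,
      ← integral_Ioc_eq_integral_Ioo, ← intervalIntegral.integral_of_le pi_pos.le, integral_sin]
    · rw [← ENNReal.ofReal_mul (by positivity), ← ENNReal.ofReal_mul (by norm_num),
        ← ENNReal.ofReal_mul (by norm_num)]
      congr 1
      norm_num
      ring
    · exact continuous_sin.continuousOn.integrableOn_Icc.mono_set Ioo_subset_Icc_self
    · filter_upwards [ae_restrict_mem measurableSet_Ioo] with θ hθ
      exact (sin_pos_of_pos_of_lt_pi hθ.1 hθ.2).le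

/-- The integral of `|A + B cos φ|` over a full period. -/
def absCosIntegral (A B : ℝ) : ℝ := ∫ φ in (-π)..π, |A + B * cos φ|

theorem absCosIntegral_nonneg (A B : ℝ) : 0 ≤ absCosIntegral A B :=
  intervalIntegral.integral_nonneg (by linarith [pi_pos]) fun _ _ => abs_nonneg _

theorem continuous_absCosIntegral : Continuous fun p : ℝ × ℝ => absCosIntegral p.1 p.2 :=
  intervalIntegral.continuous_parametric_intervalIntegral_of_continuous'
    (f := fun (p : ℝ × ℝ) φ => |p.1 + p.2 * cos φ|) (by fun_prop) _ _

theorem intervalIntegrable_abs_add_mul_cos (A B a b : ℝ) :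
    IntervalIntegrable (fun φ => |A + B * cos φ|) volume a b :=
  Continuous.intervalIntegrable (by fun_prop) _ _

theorem lintegral_enorm_add_mul_cos (A B : ℝ) :
    ∫⁻ φ in Ioo (-π) π, ‖A + B * cos φ‖ₑ = ENNReal.ofReal (absCosIntegral A B) := by
  have hπ : -π ≤ π := by linarith [pi_pos]
  rw [absCosIntegral, intervalIntegral.integral_of_le hπ, integral_Ioc_eq_integral_Ioo,
    ofReal_integral_eq_lintegral_ofReal]
  · simp_rw [← Real.norm_eq_abs, ofReal_norm]
  · exact Continuous.integrableOn_Icc (by fun_prop) |>.mono_set Ioo_subset_Icc_self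
  · exact Filter.Eventually.of_forall fun _ => abs_nonneg _

theorem absCosIntegral_neg_right (A B : ℝ) : absCosIntegral A (-B) = absCosIntegral A B := by
  have hper : Function.Periodic (fun φ => |A + B * cos φ|) (2 * π) := fun φ => by
    simp only [cos_add_two_pi]
  have h1 := hper.intervalIntegral_add_eq (-π) 0
  have h2 := intervalIntegral.integral_comp_add_right (a := -π) (b := π)
    (fun φ => |A + B * cos φ|) π
  rw [absCosIntegral, absCosIntegral]
  rw [show -π + 2 * π = π by ring] at h1
  rw [show -π + π = 0 by ring, show π + π = 0 + 2 * π by ring, ← h1] at h2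
  rw [← h2]
  refine intervalIntegral.integral_congr fun φ _ => ?_
  simp only [cos_add_pi, mul_neg, neg_mul]

theorem absCosIntegral_neg_left (A B : ℝ) : absCosIntegral (-A) B = absCosIntegral A B := by
  rw [← absCosIntegral_neg_right A B, absCosIntegral, absCosIntegral]
  refine intervalIntegral.integral_congr fun φ _ => ?_
  rw [← abs_neg]
  congr 1
  ring

theorem absCosIntegral_mono {A B B' : ℝ} (h : |B| ≤ B') :
    absCosIntegral A B ≤ absCosIntegral A B' := by
  have key : absCosIntegral A B + absCosIntegral A (-B) ≤
      absCosIntegral A B' + absCosIntegral A (-B') := by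
    simp only [absCosIntegral]
    rw [← intervalIntegral.integral_add (intervalIntegrable_abs_add_mul_cos _ _ _ _)
        (intervalIntegrable_abs_add_mul_cos _ _ _ _),
      ← intervalIntegral.integral_add (intervalIntegrable_abs_add_mul_cos _ _ _ _)
        (intervalIntegrable_abs_add_mul_cos _ _ _ _)]
    refine intervalIntegral.integral_mono_on (by linarith [pi_pos])
      ((intervalIntegrable_abs_add_mul_cos _ _ _ _).add
        (intervalIntegrable_abs_add_mul_cos _ _ _ _))
      ((intervalIntegrable_abs_add_mul_cos _ _ _ _).add
        (intervalIntegrable_abs_add_mul_cos _ _ _ _)) fun φ _ => ?_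
    have hc : |B * cos φ| ≤ |B' * cos φ| := by
      rw [abs_mul, abs_mul, abs_of_nonneg ((abs_nonneg B).trans h)]
      gcongr
    simp only [neg_mul]
    generalize B * cos φ = x at *
    generalize B' * cos φ = y at *
    rcases abs_cases x with ⟨h1, _⟩ | ⟨h1, _⟩ <;> rcases abs_cases y with ⟨h2, _⟩ | ⟨h2, _⟩ <;>
    rcases abs_cases (A + x) with ⟨h3, _⟩ | ⟨h3, _⟩ <;>
    rcases abs_cases (A + -x) with ⟨h4, _⟩ | ⟨h4, _⟩ <;> rw [h3, h4] <;>
    linarith [le_abs_self (A + y), neg_le_abs (A + y), le_abs_self (A + -y), neg_le_abs (A + -y)]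
  rw [absCosIntegral_neg_right, absCosIntegral_neg_right] at key
  linarith

theorem integral_add_mul_cos (A B a b : ℝ) :
    ∫ φ in a..b, (A + B * cos φ) = A * (b - a) + B * (sin b - sin a) := by
  rw [intervalIntegral.integral_add (by simp) (Continuous.intervalIntegrable (by fun_prop) _ _),
    intervalIntegral.integral_const, intervalIntegral.integral_const_mul, integral_cos]
  simp only [smul_eq_mul]
  ring

theorem absCosIntegral_of_abs_le {A B : ℝ} (h : |B| ≤ |A|) :
    absCosIntegral A B = 2 * π * |A| := by
  have key : ∀ A, |B| ≤ A → absCosIntegral A B = 2 * π * A := by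
    intro A h
    have : absCosIntegral A B = ∫ φ in (-π)..π, (A + B * cos φ) := by
      refine intervalIntegral.integral_congr fun φ _ => ?_
      rw [abs_of_nonneg]
      have h1 : |B * cos φ| ≤ A := by
        rw [abs_mul]
        nlinarith [abs_cos_le_one φ, abs_nonneg B]
      linarith [neg_abs_le (B * cos φ)]
    rw [this, integral_add_mul_cos]
    simp
    ring
  rcases abs_choice A with hA | hA
  · rw [hA] at h ⊢
    exact key A h
  · rw [hA] at h ⊢
    rw [← absCosIntegral_neg_left]
    exact key _ h

theorem absCosIntegral_of_abs_lt {A B : ℝ} (h : |A| < B) :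
    absCosIntegral A B = 4 * (A * arcsin (A / B) + √(B ^ 2 - A ^ 2)) := by
  have hB : 0 < B := (abs_nonneg A).trans_lt h
  have hm1 : -1 < A / B := by rw [lt_div_iff₀ hB]; linarith [neg_abs_le A]
  have hm2 : A / B < 1 := by rw [div_lt_one hB]; linarith [le_abs_self A]
  set δ := arccos (-(A / B)) with hδ
  have hcos : cos δ = -(A / B) := cos_arccos (by linarith) (by linarith)
  have hδ0 : 0 ≤ δ := arccos_nonneg _
  have hδπ : δ ≤ π := arccos_le_pi _
  have hsin : B * sin δ = √(B ^ 2 - A ^ 2) := by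
    rw [hδ, sin_arccos, show B ^ 2 - A ^ 2 = B ^ 2 * (1 - (-(A / B)) ^ 2) by field_simp,
      Real.sqrt_mul (by positivity), Real.sqrt_sq hB.le]
  have hδ' : δ = π / 2 + arcsin (A / B) := by
    rw [hδ, arccos_neg, arccos]
    ring
  have hA : A = -(B * cos δ) := by rw [hcos]; field_simp
  have i1 : ∫ φ in (-π)..(-δ), |A + B * cos φ| = ∫ φ in (-π)..(-δ), -(A + B * cos φ) := by
    refine intervalIntegral.integral_congr fun φ hφ => ?_
    rw [uIcc_of_le (by linarith)] at hφ
    rw [abs_of_nonpos]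
    have : cos φ ≤ cos δ := by
      rw [← cos_neg φ]
      exact cos_le_cos_of_nonneg_of_le_pi hδ0 (by linarith [hφ.1]) (by linarith [hφ.2])
    nlinarith
  have i2 : ∫ φ in (-δ)..δ, |A + B * cos φ| = ∫ φ in (-δ)..δ, (A + B * cos φ) := by
    refine intervalIntegral.integral_congr fun φ hφ => ?_
    rw [uIcc_of_le (by linarith)] at hφ
    rw [abs_of_nonneg]
    have : cos δ ≤ cos φ := by
      rw [← cos_abs φ]
      exact cos_le_cos_of_nonneg_of_le_pi (abs_nonneg _) hδπ (abs_le.2 hφ)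
    nlinarith
  have i3 : ∫ φ in δ..π, |A + B * cos φ| = ∫ φ in δ..π, -(A + B * cos φ) := by
    refine intervalIntegral.integral_congr fun φ hφ => ?_
    rw [uIcc_of_le (by linarith)] at hφ
    rw [abs_of_nonpos]
    have : cos φ ≤ cos δ := cos_le_cos_of_nonneg_of_le_pi hδ0 hφ.2 hφ.1
    nlinarith
  have hJ := intervalIntegrable_abs_add_mul_cos A B
  rw [absCosIntegral, ← intervalIntegral.integral_add_adjacent_intervals (hJ (-π) δ) (hJ δ π),
    ← intervalIntegral.integral_add_adjacent_intervals (hJ (-π) (-δ)) (hJ (-δ) δ), i1, i2, i3,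
    intervalIntegral.integral_neg, intervalIntegral.integral_neg, integral_add_mul_cos,
    integral_add_mul_cos, integral_add_mul_cos]
  simp only [sin_neg, sin_pi]
  rw [← hsin]
  have : arcsin (A / B) = δ - π / 2 := by linarith
  rw [this]
  ring

/-- The density, with respect to arc length, of the horizon of a curve at a point whose squared
distance from the origin is `Y`, where `ρ` is half the derivative of the squared distance. -/
def horizonDensity (Y ρ : ℝ) : ℝ :=
  1 / √Y * absCosIntegral (ρ / Y) (√(1 - 1 / Y) * √(1 - ρ ^ 2 / Y))

theorem horizonDensity_nonneg (Y ρ : ℝ) : 0 ≤ horizonDensity Y ρ :=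
  mul_nonneg (by positivity) (absCosIntegral_nonneg _ _)

theorem measurable_horizonDensity : Measurable fun p : ℝ × ℝ => horizonDensity p.1 p.2 := by
  unfold horizonDensity
  refine Measurable.mul (by fun_prop) (continuous_absCosIntegral.measurable.comp
    (f := fun p : ℝ × ℝ => (p.2 / p.1, √(1 - 1 / p.1) * √(1 - p.2 ^ 2 / p.1))) (by fun_prop))

theorem horizonDensity_of_le {Y ρ : ℝ} (hY : 1 < Y) (h : Y - ρ ^ 2 ≤ 1) :
    horizonDensity Y ρ = 2 * π * |ρ| / (Y * √Y) := by
  have hY0 : 0 < Y := by linarith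
  have hs := Real.sqrt_pos.2 hY0
  rw [horizonDensity, absCosIntegral_of_abs_le]
  · rw [abs_div, abs_of_pos hY0]
    field_simp
  · rw [abs_of_nonneg (by positivity), ← Real.sqrt_sq_eq_abs]
    rw [← Real.sqrt_mul (by rw [sub_nonneg, div_le_one hY0]; exact hY.le)]
    refine Real.sqrt_le_sqrt ?_
    rw [show (1 - 1 / Y) * (1 - ρ ^ 2 / Y) = (Y - 1) * (Y - ρ ^ 2) / Y ^ 2 by field_simp,
      div_pow]
    refine div_le_div_of_nonneg_right ?_ (by positivity)
    nlinarith

theorem horizonDensity_of_lt {Y ρ : ℝ} (h : 1 < Y - ρ ^ 2) :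
    horizonDensity Y ρ = 4 * (ρ / (Y * √Y) * arctan (ρ / (√(Y - ρ ^ 2 - 1) * √Y)) +
      √(Y - ρ ^ 2 - 1) / Y) := by
  have hY : 1 < Y := by nlinarith [sq_nonneg ρ]
  have hY0 : 0 < Y := by linarith
  have hq : 0 < √(Y - ρ ^ 2 - 1) := Real.sqrt_pos.2 (by linarith)
  have hqs : √(Y - ρ ^ 2 - 1) ^ 2 = Y - ρ ^ 2 - 1 := Real.sq_sqrt (by linarith)
  have hs := Real.sqrt_pos.2 hY0
  have hss : √Y ^ 2 = Y := Real.sq_sqrt hY0.le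
  set q := √(Y - ρ ^ 2 - 1) with hqdef
  set h' := √Y with hh
  have hB1 : 0 < 1 - 1 / Y := by rw [sub_pos, div_lt_one hY0]; exact hY
  have hB2 : 0 < 1 - ρ ^ 2 / Y := by rw [sub_pos, div_lt_one hY0]; linarith
  set B := √(1 - 1 / Y) * √(1 - ρ ^ 2 / Y) with hB
  have hBpos : 0 < B := mul_pos (Real.sqrt_pos.2 hB1) (Real.sqrt_pos.2 hB2)
  have hBsq : B ^ 2 = (Y - 1) * (Y - ρ ^ 2) / Y ^ 2 := by
    rw [hB, mul_pow, Real.sq_sqrt hB1.le, Real.sq_sqrt hB2.le]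
    field_simp
  have hdiff : B ^ 2 - (ρ / Y) ^ 2 = (q / h') ^ 2 := by
    rw [hBsq, div_pow, div_pow, hqs, hss]
    field_simp
    ring
  have hlt : |ρ / Y| < B := by
    refine abs_lt_of_sq_lt_sq ?_ hBpos.le
    have : 0 < (q / h') ^ 2 := by positivity
    linarith
  have hx1 : |ρ / Y / B| < 1 := by
    rw [abs_div, abs_of_pos hBpos, div_lt_one hBpos]
    exact hlt
  rw [horizonDensity, absCosIntegral_of_abs_lt hlt, hdiff, Real.sqrt_sq (by positivity),
    Real.arcsin_eq_arctan (abs_lt.1 hx1)]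
  have e1 : √(1 - (ρ / Y / B) ^ 2) = q / h' / B := by
    rw [show 1 - (ρ / Y / B) ^ 2 = (q / h' / B) ^ 2 by
      rw [div_pow _ B, div_pow _ B, ← hdiff]; field_simp, Real.sqrt_sq (by positivity)]
  have e2 : ρ / Y / B / (q / h' / B) = ρ / (q * h') := by
    rw [← hss]; field_simp
  rw [e1, e2]
  have e3 : q / Y = 1 / h' * (q / h') := by rw [← hss]; field_simp
  rw [e3]
  ring

theorem one_div_mul_absCosIntegral_le {h α β c : ℝ} (hc : 0 < c) (hch : c < h)
    (hαβ : α ^ 2 + β ^ 2 ≤ 1) :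
    1 / h * absCosIntegral (α * (c / h)) (β * √(1 - (c / h) ^ 2)) ≤
      1 / c * horizonDensity (h ^ 2 / c ^ 2) (h * α / c) := by
  have hh : 0 < h := hc.trans hch
  have e1 : √(h ^ 2 / c ^ 2) = h / c := by rw [← div_pow, Real.sqrt_sq (by positivity)]
  have e2 : h * α / c / (h ^ 2 / c ^ 2) = α * (c / h) := by field_simp
  have e3 : 1 - 1 / (h ^ 2 / c ^ 2) = 1 - (c / h) ^ 2 := by field_simp
  have e4 : 1 - (h * α / c) ^ 2 / (h ^ 2 / c ^ 2) = 1 - α ^ 2 := by field_simp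
  rw [horizonDensity, e1, e2, e3, e4, ← mul_assoc]
  rw [show 1 / c * (1 / (h / c)) = 1 / h by field_simp]
  refine mul_le_mul_of_nonneg_left (absCosIntegral_mono ?_) (by positivity)
  rw [abs_mul, abs_of_nonneg (Real.sqrt_nonneg (1 - (c / h) ^ 2)), mul_comm]
  refine mul_le_mul_of_nonneg_left ?_ (Real.sqrt_nonneg _)
  exact Real.abs_le_sqrt (by linarith)

theorem lintegral_ball_bandSpeed_le {x v : E3} (hv : ‖v‖ ≤ 1) {ε : ℝ} (hε1 : ε < 1) :
    ∫⁻ q in Metric.ball (0 : E3) 1, bandSpeed ε x v q ≤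
      ENNReal.ofReal (1 / 4) * ∫⁻ c in Icc (1 - ε) 1, (Iio ‖x‖).indicator (fun c =>
        ENNReal.ofReal (1 / c * horizonDensity (‖x‖ ^ 2 / c ^ 2) (inner ℝ x v / c))) c := by
  rcases eq_or_ne x 0 with rfl | hx
  · have h0 : ∀ q : E3, bandSpeed ε 0 v q = 0 := fun q => by
      rw [bandSpeed]
      rcases eq_or_ne q 0 with rfl | hq
      · refine indicator_apply_eq_zero.2 fun _ => by simp
      · refine indicator_of_notMem (fun h => ?_) _
        have h1 : (1 - ε) * ‖q‖ ≤ 0 := by simpa using h.1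
        have := mul_pos (sub_pos.2 hε1) (norm_pos_iff.2 hq)
        linarith
    simp [h0]
  obtain ⟨b, α, β, hxb, hvb⟩ := exists_orthonormalBasis_adapted x v hx
  have hh : 0 < ‖x‖ := norm_pos_iff.2 hx
  have hb0 : inner ℝ (b 0) (b 0) = (1 : ℝ) := by simp
  have hb1 : inner ℝ (b 1) (b 1) = (1 : ℝ) := by simp
  have hb01 : inner ℝ (b 0) (b 1) = (0 : ℝ) := b.inner_eq_zero (by decide)
  have hb10 : inner ℝ (b 1) (b 0) = (0 : ℝ) := b.inner_eq_zero (by decide)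
  have hαβ : α ^ 2 + β ^ 2 ≤ 1 := by
    have h1 : ‖v‖ ^ 2 = α ^ 2 + β ^ 2 := by
      rw [← real_inner_self_eq_norm_sq, hvb]
      simp only [inner_add_left, inner_add_right, real_inner_smul_left, real_inner_smul_right,
        hb0, hb1, hb01, hb10]
      ring
    rw [← h1]
    exact pow_le_one₀ (norm_nonneg _) hv
  have hr : inner ℝ x v = ‖x‖ * α := by
    conv_lhs => rw [hxb, hvb]
    simp only [inner_add_right, real_inner_smul_left, real_inner_smul_right, hb0, hb01]
    ring
  rw [hr]
  set h := ‖x‖ with hhdef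
  set S : Set (ℝ × ℝ × ℝ) := {p | (1 - ε) * √(p.1 ^ 2 + p.2.1 ^ 2 + p.2.2 ^ 2) ≤ h * p.1 ∧
    h * p.1 ≤ √(p.1 ^ 2 + p.2.1 ^ 2 + p.2.2 ^ 2)} with hS
  have hSm : MeasurableSet S := by
    have m1 : Measurable fun p : ℝ × ℝ × ℝ => √(p.1 ^ 2 + p.2.1 ^ 2 + p.2.2 ^ 2) := by fun_prop
    have m2 : Measurable fun p : ℝ × ℝ × ℝ => h * p.1 := by fun_prop
    exact (measurableSet_le (m1.const_mul (1 - ε)) m2).inter (measurableSet_le m2 m1)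
  set Φ : ℝ × ℝ × ℝ → ℝ≥0∞ := S.indicator (fun p => ‖α * p.1 + β * p.2.1‖ₑ) with hΦ
  have hΦm : Measurable Φ := Measurable.indicator (by fun_prop) hSm
  have hband : ∀ q : E3, bandSpeed ε x v q = Φ (b.repr q 0, b.repr q 1, b.repr q 2) := fun q => by
    have i1 : inner ℝ x q = h * b.repr q 0 := by
      rw [hxb, real_inner_smul_left, b.repr_apply_apply]
    have i2 : inner ℝ v q = α * b.repr q 0 + β * b.repr q 1 := by
      rw [hvb, inner_add_left, real_inner_smul_left, real_inner_smul_left, b.repr_apply_apply,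
        b.repr_apply_apply]
    have i3 : ‖q‖ = √((b.repr q 0) ^ 2 + (b.repr q 1) ^ 2 + (b.repr q 2) ^ 2) := by
      rw [← b.repr.norm_map, EuclideanSpace.norm_eq]
      simp only [Fin.sum_univ_three, Real.norm_eq_abs, sq_abs]
    simp only [bandSpeed, hΦ, hS, indicator, mem_ofPred_eq, i1, i2, i3]
  rw [lintegral_congr hband, lintegral_ball_of_homogeneous b hΦm]
  · refine mul_le_mul_right ?_ _
    set g : ℝ → ℝ≥0∞ := (Icc (1 - ε) 1).indicator fun c =>
      ENNReal.ofReal (absCosIntegral (α * (c / h)) (β * √(1 - (c / h) ^ 2))) with hg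
    have hinner : ∀ θ ∈ Ioo 0 π, ENNReal.ofReal (sin θ) *
        ∫⁻ φ in Ioo (-π) π, Φ (cos θ, sin θ * cos φ, sin θ * sin φ) =
        ENNReal.ofReal |-(h * sin θ)| * (ENNReal.ofReal (1 / h) * g (h * cos θ)) := by
      intro θ hθ
      have hs : 0 < sin θ := sin_pos_of_pos_of_lt_pi hθ.1 hθ.2
      rw [abs_neg, abs_of_pos (by positivity), ← mul_assoc,
        ← ENNReal.ofReal_mul (by positivity), show h * sin θ * (1 / h) = sin θ by field_simp]
      congr 1
      have e1 : ∀ φ, √((cos θ) ^ 2 + (sin θ * cos φ) ^ 2 + (sin θ * sin φ) ^ 2) = 1 := fun φ => by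
        rw [show (cos θ) ^ 2 + (sin θ * cos φ) ^ 2 + (sin θ * sin φ) ^ 2 = 1 by
          linear_combination sin θ ^ 2 * sin_sq_add_cos_sq φ + sin_sq_add_cos_sq θ, sqrt_one]
      have hmem : ∀ φ, (cos θ, sin θ * cos φ, sin θ * sin φ) ∈ S ↔
          h * cos θ ∈ Icc (1 - ε) 1 := fun φ => by
        simp only [hS, mem_ofPred_eq, e1, mul_one, mem_Icc]
      by_cases hc : h * cos θ ∈ Icc (1 - ε) 1
      · rw [hg, indicator_of_mem hc, ← lintegral_enorm_add_mul_cos]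
        refine lintegral_congr fun φ => ?_
        rw [hΦ, indicator_of_mem ((hmem φ).2 hc), mul_div_cancel_left₀ _ hh.ne',
          ← sin_sq, Real.sqrt_sq hs.le]
        simp only [mul_assoc]
      · rw [hg, indicator_of_notMem hc]
        have : ∀ φ, Φ (cos θ, sin θ * cos φ, sin θ * sin φ) = 0 := fun φ =>
          indicator_of_notMem (fun hm => hc ((hmem φ).1 hm)) _
        simp [this]
    rw [setLIntegral_congr_fun measurableSet_Ioo hinner]
    rw [← lintegral_image_eq_lintegral_abs_deriv_mul (f := fun θ => h * cos θ)
      (g := fun c => ENNReal.ofReal (1 / h) * g c) measurableSet_Ioo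
      (fun θ _ => by
        have := ((hasDerivAt_cos θ).const_mul h).hasDerivWithinAt (s := Ioo 0 π)
        rwa [mul_neg] at this)
      (fun θ hθ θ' hθ' he => injOn_cos (Ioo_subset_Icc_self hθ) (Ioo_subset_Icc_self hθ')
        (mul_left_cancel₀ hh.ne' he))]
    have hsub : (fun θ => h * cos θ) '' Ioo 0 π ⊆ Iio h := by
      rintro _ ⟨θ, hθ, rfl⟩
      have : cos θ < cos 0 := cos_lt_cos_of_nonneg_of_le_pi le_rfl hθ.2.le hθ.1
      rw [cos_zero] at this
      change h * cos θ < h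
      nlinarith
    refine (lintegral_mono_set hsub).trans ?_
    rw [← lintegral_indicator measurableSet_Iio, ← lintegral_indicator measurableSet_Icc]
    refine lintegral_mono fun c => ?_
    by_cases hc : c ∈ Icc (1 - ε) 1
    · by_cases hch : c ∈ Iio h
      · rw [indicator_of_mem hch, indicator_of_mem hc, indicator_of_mem hch, hg,
          indicator_of_mem hc, ← ENNReal.ofReal_mul (by positivity)]
        exact ENNReal.ofReal_le_ofReal
          (one_div_mul_absCosIntegral_le (by linarith [hc.1]) hch hαβ)
      · rw [indicator_of_notMem hch]
        exact zero_le
    · rw [indicator_of_notMem hc]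
      refine (indicator_apply_eq_zero.2 fun _ => ?_).le
      rw [hg, indicator_of_notMem hc, mul_zero]
  · intro r hr x y z
    have e1 : √((r * x) ^ 2 + (r * y) ^ 2 + (r * z) ^ 2) = r * √(x ^ 2 + y ^ 2 + z ^ 2) := by
      rw [show (r * x) ^ 2 + (r * y) ^ 2 + (r * z) ^ 2 = r ^ 2 * (x ^ 2 + y ^ 2 + z ^ 2) by ring,
        Real.sqrt_mul (by positivity), Real.sqrt_sq hr.le]
    have hmem : (r * x, r * y, r * z) ∈ S ↔ (x, y, z) ∈ S := by
      simp only [hS, mem_ofPred_eq, e1]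
      rw [show (1 - ε) * (r * √(x ^ 2 + y ^ 2 + z ^ 2)) =
        r * ((1 - ε) * √(x ^ 2 + y ^ 2 + z ^ 2)) by ring, show h * (r * x) = r * (h * x) by ring,
        mul_le_mul_iff_right₀ hr, mul_le_mul_iff_right₀ hr]
    by_cases hm : (x, y, z) ∈ S
    · rw [hΦ, indicator_of_mem hm, indicator_of_mem (hmem.2 hm)]
      simp only
      rw [show α * (r * x) + β * (r * y) = r * (α * x + β * y) by ring, enorm_mul]
      congr 1
      rw [← ofReal_norm, Real.norm_eq_abs, abs_of_pos hr]
    · rw [hΦ, indicator_of_notMem hm, indicator_of_notMem (fun h => hm (hmem.1 h)), mul_zero]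

/-- The horizon density with respect to the sphere of radius `c`, for a point at squared distance
`y` from the origin, where `r` is half the derivative of the squared distance. -/
def levelDensity (c y r : ℝ) : ℝ≥0∞ :=
  {y : ℝ | c ^ 2 < y}.indicator
    (fun y => ENNReal.ofReal (1 / c * horizonDensity (y / c ^ 2) (r / c))) y

theorem measurable_levelDensity {y r : ℝ → ℝ} (hy : Measurable y) (hr : Measurable r) :
    Measurable fun z : ℝ × ℝ => levelDensity z.2 (y z.1) (r z.1) := by
  have h1 : MeasurableSet {z : ℝ × ℝ | z.2 ^ 2 < y z.1} :=
    measurableSet_lt (by fun_prop) (by fun_prop)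
  have h2 : Measurable fun z : ℝ × ℝ => horizonDensity (y z.1 / z.2 ^ 2) (r z.1 / z.2) :=
    measurable_horizonDensity.comp (f := fun z : ℝ × ℝ => (y z.1 / z.2 ^ 2, r z.1 / z.2))
      (by fun_prop)
  have h3 : Measurable fun z : ℝ × ℝ =>
      ENNReal.ofReal (1 / z.2 * horizonDensity (y z.1 / z.2 ^ 2) (r z.1 / z.2)) := by fun_prop
  exact h3.indicator h1

theorem lintegral_levelDensity_swap {y r : ℝ → ℝ} (hy : Measurable y) (hr : Measurable r)
    (S T : Set ℝ) :
    ∫⁻ t in T, ∫⁻ c in S, levelDensity c (y t) (r t) =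
      ∫⁻ c in S, ∫⁻ t in T, levelDensity c (y t) (r t) :=
  lintegral_lintegral_swap (measurable_levelDensity hy hr).aemeasurable

theorem ofReal_le_lintegral_levelDensity {L : ℝ} {γ : AddCircle L → E3}
    (hγ : IsInspectionCurve L γ) (s : ℝ) {ε : ℝ} (hε : 0 ≤ ε) (hε1 : ε < 1) :
    ENNReal.ofReal (8 * π * ε) ≤ ∫⁻ c in Icc (1 - ε) 1, ∫⁻ t in Ioc s (s + L),
      levelDensity c (‖liftCurve L γ t‖ ^ 2) (deriv (fun t => ‖liftCurve L γ t‖ ^ 2) t / 2) := by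
  have hlip : LipschitzWith 1 (liftCurve L γ) := liftCurve_lipschitz hγ
  set f := liftCurve L γ with hf
  have h1 := lintegral_norm_ball_le_lintegral_bandSpeed hγ s hε hε1.le
  rw [lintegral_ball_ofReal_norm hε] at h1
  have h2 : ∫⁻ t in Ioc s (s + L), ∫⁻ q in Metric.ball (0 : E3) 1,
      bandSpeed ε (f t) (deriv f t) q ≤ ∫⁻ t in Ioc s (s + L), ENNReal.ofReal (1 / 4) *
        ∫⁻ c in Icc (1 - ε) 1,
          levelDensity c (‖f t‖ ^ 2) (deriv (fun t => ‖f t‖ ^ 2) t / 2) := by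
    refine lintegral_mono_ae (ae_restrict_of_ae ?_)
    filter_upwards [hlip.ae_differentiableAt] with t ht
    have hv : ‖deriv f t‖ ≤ 1 := by
      simpa using norm_deriv_le_of_lipschitz hlip (x₀ := t)
    have hd : deriv (fun t => ‖f t‖ ^ 2) t / 2 = inner ℝ (f t) (deriv f t) := by
      rw [ht.hasDerivAt.norm_sq.deriv]
      ring
    rw [hd]
    refine (lintegral_ball_bandSpeed_le hv hε1).trans (le_of_eq ?_)
    congr 1
    refine setLIntegral_congr_fun measurableSet_Icc fun c hc => ?_
    have hc0 : 0 ≤ c := by linarith [hc.1]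
    have hiff : c ∈ Iio ‖f t‖ ↔ c ^ 2 < ‖f t‖ ^ 2 := by
      rw [mem_Iio, pow_lt_pow_iff_left₀ hc0 (norm_nonneg _) two_ne_zero]
    simp only [levelDensity, indicator, mem_ofPred_eq, hiff]
  have h3 := h1.trans h2
  rw [lintegral_const_mul' _ _ ENNReal.ofReal_ne_top] at h3
  have hy : Measurable fun t => ‖f t‖ ^ 2 := by
    exact (hlip.continuous.norm.pow 2).measurable
  rw [lintegral_levelDensity_swap hy ((measurable_deriv _).div_const 2)] at h3
  have h4 := mul_le_mul_right h3 (ENNReal.ofReal 4)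
  rw [← mul_assoc, ← ENNReal.ofReal_mul (by norm_num), ← ENNReal.ofReal_mul (by norm_num)] at h4
  rwa [show (4 : ℝ) * (1 / 4) = 1 by norm_num, ENNReal.ofReal_one, one_mul,
    show 4 * (2 * π * ε) = 8 * π * ε by ring] at h4

/-- The horizon density at the point of a line nearest to the origin, as a function of the squared
distance of the line from the origin. -/
def tangentDensity (x : ℝ) : ℝ := 4 * √(x - 1) / max x 1

theorem continuous_tangentDensity : Continuous tangentDensity := by
  unfold tangentDensity
  exact Continuous.div (by fun_prop) (by fun_prop) fun x => by positivity

theorem tangentDensity_of_le {x : ℝ} (hx : x ≤ 1) : tangentDensity x = 0 := by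
  rw [tangentDensity, Real.sqrt_eq_zero_of_nonpos (by linarith)]
  simp

theorem tangentDensity_of_one_le {x : ℝ} (hx : 1 ≤ x) : tangentDensity x = 4 * √(x - 1) / x := by
  rw [tangentDensity, max_eq_left hx]

theorem tangentDensity_nonneg (x : ℝ) : 0 ≤ tangentDensity x := by
  unfold tangentDensity
  positivity

theorem two_mul_sqrt_sub_one_le (x : ℝ) : 2 * √(x - 1) ≤ max x 1 := by
  rcases le_total x 1 with hx | hx
  · rw [Real.sqrt_eq_zero_of_nonpos (by linarith)]
    simp
  · rw [max_eq_left hx]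
    nlinarith [Real.sq_sqrt (sub_nonneg.2 hx), sq_nonneg (√(x - 1) - 1)]

theorem tangentDensity_le_two (x : ℝ) : tangentDensity x ≤ 2 := by
  rw [tangentDensity, div_le_iff₀ (by positivity)]
  linarith [two_mul_sqrt_sub_one_le x]

theorem tangentDensity_lt_two {x : ℝ} (hx : x ≠ 2) : tangentDensity x < 2 := by
  rcases le_or_gt x 1 with h | h
  · rw [tangentDensity_of_le h]
    norm_num
  · rw [tangentDensity_of_one_le h.le, div_lt_iff₀ (by linarith)]
    have hs := Real.sq_sqrt (sub_nonneg.2 h.le)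
    have hne : √(x - 1) - 1 ≠ 0 := fun he => hx (by nlinarith)
    have := sq_pos_of_ne_zero hne
    nlinarith

theorem abs_tangentDensity_sub_le {x x' : ℝ} (h : x ≤ x') :
    |tangentDensity x' - tangentDensity x| ≤ 4 * (√(x' - 1) - √(x - 1)) + 2 * (x' - x) := by
  have hm : √(x - 1) ≤ √(x' - 1) := Real.sqrt_le_sqrt (by linarith)
  have hM1 : 1 ≤ max x 1 := le_max_right _ _
  have hM1' : 1 ≤ max x' 1 := le_max_right _ _
  have hMM : max x 1 ≤ max x' 1 := max_le_max_right 1 h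
  have hMd : max x' 1 - max x 1 ≤ x' - x := by
    rcases le_total x 1 with h1 | h1 <;> rcases le_total x' 1 with h2 | h2 <;>
      simp only [h1, h2, max_eq_left, max_eq_right] <;> linarith
  have hh := two_mul_sqrt_sub_one_le x
  have hm0 := Real.sqrt_nonneg (x - 1)
  rw [tangentDensity, tangentDensity]
  generalize √(x - 1) = m at *
  generalize √(x' - 1) = m' at *
  generalize max x 1 = M at *
  generalize max x' 1 = M' at *
  have hMp : 0 < M := by linarith
  have hMp' : 0 < M' := by linarith
  have e : 4 * m' / M' - 4 * m / M = 4 * ((m' - m) / M') - 4 * (m / M) * ((M' - M) / M') := by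
    field_simp
    ring
  have a1 : 0 ≤ (m' - m) / M' := div_nonneg (by linarith) hMp'.le
  have a2 : (m' - m) / M' ≤ m' - m := div_le_self (by linarith) hM1'
  have a3 : 0 ≤ (M' - M) / M' := div_nonneg (by linarith) hMp'.le
  have a4 : (M' - M) / M' ≤ x' - x := (div_le_self (by linarith) hM1').trans hMd
  have a5 : 0 ≤ m / M := by positivity
  have a6 : m / M ≤ 1 / 2 := by rw [div_le_iff₀ hMp]; linarith
  have a7 : 0 ≤ 4 * (m / M) * ((M' - M) / M') := by positivity
  have a8 : 4 * (m / M) * ((M' - M) / M') ≤ 2 * (x' - x) := by nlinarith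
  rw [e, abs_le]
  constructor <;> linarith

theorem integral_sqrt_sub_sq {B M : ℝ} (hM : 0 ≤ M) (hB : B ≤ M ^ 2) :
    ∫ u in (-M)..M, √(B - u ^ 2) = π / 2 * max B 0 := by
  rcases le_or_gt B 0 with h | h
  · rw [max_eq_right h]
    have : ∀ u, √(B - u ^ 2) = 0 := fun u => Real.sqrt_eq_zero_of_nonpos (by nlinarith [sq_nonneg u])
    simp [this]
  · rw [max_eq_left h.le]
    set s := √B with hs
    have hs0 : 0 < s := Real.sqrt_pos.2 h
    have hss : s ^ 2 = B := Real.sq_sqrt h.le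
    have hsM : s ≤ M := by
      rw [hs, Real.sqrt_le_left hM]
      exact hB
    have hc : ∀ a b, IntervalIntegrable (fun u => √(B - u ^ 2)) volume a b := fun a b =>
      Continuous.intervalIntegrable (by fun_prop) _ _
    have z : ∀ a b, (∀ u ∈ uIcc a b, s ≤ |u|) → ∫ u in a..b, √(B - u ^ 2) = 0 := by
      intro a b hab
      rw [intervalIntegral.integral_congr (g := fun _ => (0 : ℝ)) fun u hu => ?_]
      · simp
      · refine Real.sqrt_eq_zero_of_nonpos ?_
        have := hab u hu
        rw [← sq_abs u]
        nlinarith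
    rw [← intervalIntegral.integral_add_adjacent_intervals (hc (-M) s) (hc s M),
      ← intervalIntegral.integral_add_adjacent_intervals (hc (-M) (-s)) (hc (-s) s),
      z (-M) (-s), z s M, zero_add, add_zero]
    · have h1 := intervalIntegral.smul_integral_comp_mul_left (a := -1) (b := 1)
        (fun u => √(B - u ^ 2)) s
      rw [mul_neg, mul_one] at h1
      rw [← h1]
      have h2 : ∀ w, √(B - (s * w) ^ 2) = s * √(1 - w ^ 2) := fun w => by
        rw [show B - (s * w) ^ 2 = s ^ 2 * (1 - w ^ 2) by rw [hss]; rw [mul_pow, hss]; ring,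
          Real.sqrt_mul (by positivity), Real.sqrt_sq hs0.le]
      simp_rw [h2]
      rw [intervalIntegral.integral_const_mul, integral_sqrt_one_sub_sq, smul_eq_mul, ← hss]
      ring
    · intro u hu
      rw [uIcc_of_le hsM] at hu
      exact hu.1.trans (le_abs_self u)
    · intro u hu
      rw [uIcc_of_le (by linarith)] at hu
      linarith [neg_le_abs u, hu.2]

theorem integral_sqrt_sub_sq_sub_le {B B' R : ℝ} (hR : 0 ≤ R) (h : B ≤ B') :
    ∫ u in (-R)..R, (√(B' - u ^ 2) - √(B - u ^ 2)) ≤ 2 * (B' - B) := by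
  set M := max R √B' with hMdef
  have hM : 0 ≤ M := hR.trans (le_max_left _ _)
  have hB' : B' ≤ M ^ 2 := by
    rcases le_or_gt B' 0 with h0 | h0
    · nlinarith [sq_nonneg M]
    · rw [← Real.sqrt_le_left hM]
      exact le_max_right _ _
  have hnn : ∀ u, 0 ≤ √(B' - u ^ 2) - √(B - u ^ 2) := fun u =>
    sub_nonneg.2 (Real.sqrt_le_sqrt (by linarith))
  have h1 : ∫ u in (-R)..R, (√(B' - u ^ 2) - √(B - u ^ 2)) ≤
      ∫ u in (-M)..M, (√(B' - u ^ 2) - √(B - u ^ 2)) := by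
    refine intervalIntegral.integral_mono_interval (neg_le_neg (le_max_left _ _)) (by linarith)
      (le_max_left _ _) (Filter.Eventually.of_forall hnn)
      (Continuous.intervalIntegrable (by fun_prop) _ _)
  rw [intervalIntegral.integral_sub (a := -M) (Continuous.intervalIntegrable (by fun_prop) _ _)
    (Continuous.intervalIntegrable (by fun_prop) _ _), integral_sqrt_sub_sq hM hB',
    integral_sqrt_sub_sq hM (h.trans hB')] at h1
  have h2 : max B' 0 - max B 0 ≤ B' - B := by
    rcases le_total B 0 with h1 | h1 <;> rcases le_total B' 0 with h2 | h2 <;>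
      simp only [h1, h2, max_eq_left, max_eq_right] <;> linarith
  have h3 : 0 ≤ max B' 0 - max B 0 := sub_nonneg.2 (max_le_max_right 0 h)
  nlinarith [pi_le_four, pi_pos]

/-- The horizon of the segment of a line from its point nearest to the origin to the point at
squared distance `Y`, where `ρ` is the signed length of the segment. -/
def segmentHorizon (Y ρ : ℝ) : ℝ := ∫ u in (0)..ρ, tangentDensity (Y - u ^ 2)

theorem continuous_tangentDensity_sub_sq (Y : ℝ) :
    Continuous fun u => tangentDensity (Y - u ^ 2) :=
  continuous_tangentDensity.comp (by fun_prop)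

theorem hasDerivAt_segmentHorizon (Y ρ : ℝ) :
    HasDerivAt (segmentHorizon Y) (tangentDensity (Y - ρ ^ 2)) ρ :=
  intervalIntegral.integral_hasDerivAt_right
    ((continuous_tangentDensity_sub_sq Y).intervalIntegrable _ _)
    (continuous_tangentDensity_sub_sq Y).stronglyMeasurable.stronglyMeasurableAtFilter
    (continuous_tangentDensity_sub_sq Y).continuousAt

theorem segmentHorizon_zero (Y : ℝ) : segmentHorizon Y 0 = 0 := by
  simp [segmentHorizon]

theorem segmentHorizon_neg (Y ρ : ℝ) : segmentHorizon Y (-ρ) = -segmentHorizon Y ρ := by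
  have h := intervalIntegral.integral_comp_neg (a := 0) (b := ρ)
    (fun u => tangentDensity (Y - u ^ 2))
  simp only [neg_sq, neg_zero] at h
  rw [segmentHorizon, segmentHorizon, h, intervalIntegral.integral_symm]

theorem abs_segmentHorizon_sub_le {Y Y' ρ R : ℝ} (hρ : |ρ| ≤ R) (h : Y ≤ Y') :
    |segmentHorizon Y' ρ - segmentHorizon Y ρ| ≤ (8 + 4 * R) * (Y' - Y) := by
  have hR : 0 ≤ R := (abs_nonneg _).trans hρ
  have hρ' := abs_le.1 hρ
  rw [segmentHorizon, segmentHorizon, ← intervalIntegral.integral_sub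
    ((continuous_tangentDensity_sub_sq _).intervalIntegrable _ _)
    ((continuous_tangentDensity_sub_sq _).intervalIntegrable _ _)]
  set G : ℝ → ℝ := fun u => 4 * (√((Y' - 1) - u ^ 2) - √((Y - 1) - u ^ 2)) + 2 * (Y' - Y) with hG
  have hGc : Continuous G := by fun_prop
  have hle : ∀ u, |tangentDensity (Y' - u ^ 2) - tangentDensity (Y - u ^ 2)| ≤ G u := fun u => by
    have := abs_tangentDensity_sub_le (x := Y - u ^ 2) (x' := Y' - u ^ 2) (by linarith)
    simp only [hG]
    rw [show Y' - 1 - u ^ 2 = Y' - u ^ 2 - 1 by ring, show Y - 1 - u ^ 2 = Y - u ^ 2 - 1 by ring]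
    linarith
  have hG0 : ∀ u, 0 ≤ G u := fun u => (abs_nonneg _).trans (hle u)
  have h1 : |∫ u in (0)..ρ, (tangentDensity (Y' - u ^ 2) - tangentDensity (Y - u ^ 2))| ≤
      |∫ u in (0)..ρ, G u| := by
    exact intervalIntegral.norm_integral_le_abs_of_norm_le (μ := volume)
      (f := fun u => tangentDensity (Y' - u ^ 2) - tangentDensity (Y - u ^ 2))
      (Filter.Eventually.of_forall hle) (hGc.intervalIntegrable _ _)
  have h2 : |∫ u in (0)..ρ, G u| ≤ ∫ u in (-R)..R, G u := by
    rcases le_total 0 ρ with h0 | h0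
    · rw [abs_of_nonneg (intervalIntegral.integral_nonneg h0 fun u _ => hG0 u)]
      exact intervalIntegral.integral_mono_interval (by linarith) h0 hρ'.2
        (Filter.Eventually.of_forall hG0) (hGc.intervalIntegrable _ _)
    · rw [intervalIntegral.integral_symm, abs_neg,
        abs_of_nonneg (intervalIntegral.integral_nonneg h0 fun u _ => hG0 u)]
      exact intervalIntegral.integral_mono_interval hρ'.1 h0 hR
        (Filter.Eventually.of_forall hG0) (hGc.intervalIntegrable _ _)
  refine (h1.trans h2).trans ?_
  rw [hG, intervalIntegral.integral_add (Continuous.intervalIntegrable (by fun_prop) _ _) (by simp),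
    intervalIntegral.integral_const_mul, intervalIntegral.integral_const]
  have := integral_sqrt_sub_sq_sub_le (B := Y - 1) (B' := Y' - 1) hR (by linarith)
  simp only [smul_eq_mul]
  nlinarith

theorem hasDerivAt_arctan_sub_arctan {Y ρ : ℝ → ℝ} {Y' p u : ℝ} (hY : HasDerivAt Y Y' u)
    (hρ : HasDerivAt ρ p u) (h : 1 < Y u - ρ u ^ 2) :
    HasDerivAt (fun u => 4 * (arctan (ρ u / √(Y u - ρ u ^ 2 - 1)) -
        arctan (ρ u / (√(Y u - ρ u ^ 2 - 1) * √(Y u))) / √(Y u)))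
      ((2 * arctan (ρ u / (√(Y u - ρ u ^ 2 - 1) * √(Y u))) / (Y u * √(Y u)) -
        2 * √(Y u - ρ u ^ 2 - 1) * ρ u / (Y u * (Y u - ρ u ^ 2))) * Y' +
        4 * √(Y u - ρ u ^ 2 - 1) / (Y u - ρ u ^ 2) * p) u := by
  have hY1 : 1 < Y u := by nlinarith [sq_nonneg (ρ u)]
  have hdq : HasDerivAt (fun u => √(Y u - ρ u ^ 2 - 1))
      ((Y' - 2 * ρ u * p) / (2 * √(Y u - ρ u ^ 2 - 1))) u := by
    have h1 : HasDerivAt (fun u => Y u - ρ u ^ 2 - 1) (Y' - 2 * ρ u * p) u := by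
      have := (hY.sub (hρ.pow 2)).sub_const 1
      refine this.congr_deriv ?_
      simp
    exact h1.sqrt (by linarith)
  have hdh : HasDerivAt (fun u => √(Y u)) (Y' / (2 * √(Y u))) u := hY.sqrt (by linarith)
  have hq : 0 < √(Y u - ρ u ^ 2 - 1) := Real.sqrt_pos.2 (by linarith)
  have hqs : √(Y u - ρ u ^ 2 - 1) ^ 2 = Y u - ρ u ^ 2 - 1 := Real.sq_sqrt (by linarith)
  have hh : 0 < √(Y u) := Real.sqrt_pos.2 (by linarith)
  have hhs : √(Y u) ^ 2 = Y u := Real.sq_sqrt (by linarith)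
  have h1 := (hρ.div hdq hq.ne').arctan
  have h2 := (hρ.div (hdq.mul hdh) (mul_pos hq hh).ne').arctan
  have h3 := (h1.sub (h2.div hdh hh.ne')).const_mul 4
  refine h3.congr_deriv ?_
  simp only [Pi.mul_apply, Pi.div_apply]
  generalize arctan (ρ u / (√(Y u - ρ u ^ 2 - 1) * √(Y u))) = w
  generalize √(Y u - ρ u ^ 2 - 1) = q at *
  generalize √(Y u) = h' at *
  have hYe : Y u = 1 + q ^ 2 + ρ u ^ 2 := by linarith
  rw [← hhs]
  have hsub : h' ^ 2 - ρ u ^ 2 = 1 + q ^ 2 := by rw [hhs]; linarith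
  have hh2 : h' ^ 2 = 1 + q ^ 2 + ρ u ^ 2 := by rw [hhs]; linarith
  rw [hsub]
  have e1 : 1 + (ρ u / q) ^ 2 = (q ^ 2 + ρ u ^ 2) / q ^ 2 := by field_simp
  have e2 : 1 + (ρ u / (q * h')) ^ 2 = (q ^ 2 + ρ u ^ 2) * (1 + q ^ 2) / (q ^ 2 * h' ^ 2) := by
    rw [hh2]
    have : h' ^ 2 ≠ 0 := by positivity
    rw [div_pow, mul_pow, hh2]
    have : 1 + q ^ 2 + ρ u ^ 2 ≠ 0 := by positivity
    field_simp
    ring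
  rw [e1, e2]
  have hS : q ^ 2 + ρ u ^ 2 ≠ 0 := by positivity
  have hT : 1 + q ^ 2 ≠ 0 := by positivity
  field_simp
  linear_combination (-4 * h' * q ^ 2 * ρ u * Y') * hh2

theorem segmentHorizon_of_lt {Y ρ : ℝ} (h : 1 < Y - ρ ^ 2) :
    segmentHorizon Y ρ = 4 * (arctan (ρ / √(Y - ρ ^ 2 - 1)) -
      arctan (ρ / (√(Y - ρ ^ 2 - 1) * √Y)) / √Y) := by
  have hd : ∀ u ∈ uIcc 0 ρ, HasDerivAt (fun u => 4 * (arctan (u / √(Y - u ^ 2 - 1)) -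
      arctan (u / (√(Y - u ^ 2 - 1) * √Y)) / √Y)) (tangentDensity (Y - u ^ 2)) u := by
    intro u hu
    have hu2 : u ^ 2 ≤ ρ ^ 2 := by
      rcases le_total 0 ρ with h0 | h0
      · rw [uIcc_of_le h0] at hu
        nlinarith [hu.1, hu.2]
      · rw [uIcc_of_ge h0] at hu
        nlinarith [hu.1, hu.2]
    have := hasDerivAt_arctan_sub_arctan (hasDerivAt_const u Y) (hasDerivAt_id u)
      (by simp only [id]; linarith)
    simp only [id, mul_zero, zero_add, mul_one] at this
    rwa [tangentDensity_of_one_le (by linarith)]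
  rw [segmentHorizon, intervalIntegral.integral_eq_sub_of_hasDerivAt hd
    ((continuous_tangentDensity_sub_sq Y).intervalIntegrable _ _)]
  simp

theorem segmentHorizon_of_one_le {Y ρ : ℝ} (hY : 1 < Y) (hρ : 0 ≤ ρ) (h : Y - ρ ^ 2 ≤ 1) :
    segmentHorizon Y ρ = 2 * π * (1 - 1 / √Y) := by
  set r := √(Y - 1) with hr
  have hr0 : 0 < r := Real.sqrt_pos.2 (by linarith)
  have hrs : r ^ 2 = Y - 1 := Real.sq_sqrt (by linarith)
  have hh : 0 < √Y := Real.sqrt_pos.2 (by linarith)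
  have hrρ : r ≤ ρ := by
    rw [hr, Real.sqrt_le_left hρ]
    linarith
  have h1 : segmentHorizon Y ρ = segmentHorizon Y r := by
    have hc := continuous_tangentDensity_sub_sq Y
    rw [segmentHorizon, ← intervalIntegral.integral_add_adjacent_intervals
      (hc.intervalIntegrable 0 r) (hc.intervalIntegrable r ρ),
      intervalIntegral.integral_congr (a := r) (g := fun _ => (0 : ℝ)) fun u hu => ?_]
    · simp [segmentHorizon]
    · rw [uIcc_of_le hrρ] at hu
      exact tangentDensity_of_le (by nlinarith [hu.1])
  have hlim : Filter.Tendsto (segmentHorizon Y) (nhdsWithin r (Iio r))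
      (nhds (segmentHorizon Y r)) :=
    (hasDerivAt_segmentHorizon Y r).continuousAt.tendsto.mono_left nhdsWithin_le_nhds
  have hsq : Filter.Tendsto (fun u => √(Y - u ^ 2 - 1)) (nhdsWithin r (Iio r))
      (nhdsWithin 0 (Ioi 0)) := by
    refine tendsto_nhdsWithin_iff.2 ⟨?_, ?_⟩
    · have : Continuous fun u : ℝ => √(Y - u ^ 2 - 1) := by fun_prop
      have h2 := (this.tendsto r).mono_left (nhdsWithin_le_nhds (s := Iio r))
      rwa [hrs, show Y - (Y - 1) - 1 = 0 by ring, Real.sqrt_zero] at h2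
    · filter_upwards [Ioo_mem_nhdsLT hr0] with u hu
      exact Real.sqrt_pos.2 (by nlinarith [hu.1, hu.2])
  have hid : Filter.Tendsto (fun u : ℝ => u) (nhdsWithin r (Iio r)) (nhds r) :=
    Filter.tendsto_id.mono_left nhdsWithin_le_nhds
  have ht1 : Filter.Tendsto (fun u => u / √(Y - u ^ 2 - 1)) (nhdsWithin r (Iio r))
      Filter.atTop := by
    have := hid.pos_mul_atTop hr0 (tendsto_inv_nhdsGT_zero.comp hsq)
    simp only [Function.comp_def] at this
    simpa only [div_eq_mul_inv] using this
  have ht2 : Filter.Tendsto (fun u => u / (√(Y - u ^ 2 - 1) * √Y)) (nhdsWithin r (Iio r))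
      Filter.atTop := by
    have := ht1.atTop_div_const hh
    simpa only [div_div] using this
  have harc : Filter.Tendsto arctan Filter.atTop (nhds (π / 2)) :=
    tendsto_arctan_atTop.mono_right nhdsWithin_le_nhds
  have hlim' := (((harc.comp ht1).sub ((harc.comp ht2).div_const √Y)).const_mul 4)
  rw [h1]
  refine (tendsto_nhds_unique (hlim.congr' ?_) hlim').trans ?_
  · filter_upwards [Ioo_mem_nhdsLT hr0] with u hu
    exact segmentHorizon_of_lt (by nlinarith [hu.1, hu.2])
  · field_simp
    ring

theorem segmentHorizon_of_le_one {Y : ℝ} (hY : Y ≤ 1) (ρ : ℝ) : segmentHorizon Y ρ = 0 := by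
  have : ∀ u, tangentDensity (Y - u ^ 2) = 0 := fun u =>
    tangentDensity_of_le (by nlinarith [sq_nonneg u])
  simp [segmentHorizon, this]

/-- The horizon density, set to zero inside the unit sphere. -/
def outerDensity (Y ρ : ℝ) : ℝ := if 1 < Y then horizonDensity Y ρ else 0

theorem outerDensity_nonneg (Y ρ : ℝ) : 0 ≤ outerDensity Y ρ := by
  unfold outerDensity
  split_ifs
  exacts [horizonDensity_nonneg _ _, le_rfl]

theorem hasDerivAt_segmentHorizon_comp {Y ρ : ℝ → ℝ} {κ p u : ℝ}
    (hY : HasDerivAt Y (2 * κ * ρ u) u) (hρ : HasDerivAt ρ p u) (h1 : Y u ≠ 1)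
    (h2 : Y u - ρ u ^ 2 ≠ 1) :
    HasDerivAt (fun u => segmentHorizon (Y u) (ρ u))
      (κ * outerDensity (Y u) (ρ u) - tangentDensity (Y u - ρ u ^ 2) * (κ - p)) u := by
  have hYc := hY.continuousAt
  have hxc : ContinuousAt (fun u => Y u - ρ u ^ 2) u := hYc.sub (hρ.continuousAt.pow 2)
  rcases lt_or_gt_of_ne h1 with hlt | hgt
  · have he : (fun u => segmentHorizon (Y u) (ρ u)) =ᶠ[nhds u] fun _ => 0 := by
      filter_upwards [hYc.eventually_lt_const hlt] with v hv
      exact segmentHorizon_of_le_one hv.le _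
    rw [outerDensity, if_neg hlt.not_gt, tangentDensity_of_le (by nlinarith [sq_nonneg (ρ u)])]
    simpa using (hasDerivAt_const u (0 : ℝ)).congr_of_eventuallyEq he
  rw [outerDensity, if_pos hgt]
  rcases lt_or_gt_of_ne h2 with hxlt | hxgt
  · have hh : 0 < √(Y u) := Real.sqrt_pos.2 (by linarith)
    have hhs : √(Y u) ^ 2 = Y u := Real.sq_sqrt (by linarith)
    have hdh : HasDerivAt (fun u => √(Y u)) (2 * κ * ρ u / (2 * √(Y u))) u :=
      hY.sqrt (by linarith)
    have hd : HasDerivAt (fun u => 2 * π * (1 - 1 / √(Y u)))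
        (2 * π * (κ * ρ u) / (Y u * √(Y u))) u := by
      have h3 := (((hdh.inv hh.ne').const_sub 1).const_mul (2 * π))
      simp only [one_div]
      refine h3.congr_deriv ?_
      rw [← hhs]
      rw [Real.sqrt_sq hh.le]
      field_simp
    rw [horizonDensity_of_le hgt hxlt.le, tangentDensity_of_le hxlt.le]
    have hρ0 : ρ u ≠ 0 := fun h0 => by rw [h0] at hxlt; nlinarith
    have hev : ∀ᶠ v in nhds u, 1 < Y v ∧ Y v - ρ v ^ 2 < 1 :=
      (hYc.eventually_const_lt hgt).and (hxc.eventually_lt_const hxlt)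
    rcases lt_or_gt_of_ne hρ0 with hn | hp
    · have he : (fun u => segmentHorizon (Y u) (ρ u)) =ᶠ[nhds u]
          fun u => -(2 * π * (1 - 1 / √(Y u))) := by
        filter_upwards [hev, hρ.continuousAt.eventually_lt_const hn] with v hv hv'
        rw [← segmentHorizon_of_one_le hv.1 (neg_nonneg.2 hv'.le) (by rw [neg_sq]; exact hv.2.le),
          segmentHorizon_neg, neg_neg]
      refine (hd.neg.congr_of_eventuallyEq he).congr_deriv ?_
      rw [abs_of_neg hn]
      ring
    · have he : (fun u => segmentHorizon (Y u) (ρ u)) =ᶠ[nhds u]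
          fun u => (2 * π * (1 - 1 / √(Y u))) := by
        filter_upwards [hev, hρ.continuousAt.eventually_const_lt hp] with v hv hv'
        exact segmentHorizon_of_one_le hv.1 hv'.le hv.2.le
      refine (hd.congr_of_eventuallyEq he).congr_deriv ?_
      rw [abs_of_pos hp]
      ring
  · have he : (fun u => segmentHorizon (Y u) (ρ u)) =ᶠ[nhds u] fun u =>
        4 * (arctan (ρ u / √(Y u - ρ u ^ 2 - 1)) -
        arctan (ρ u / (√(Y u - ρ u ^ 2 - 1) * √(Y u))) / √(Y u)) := by
      filter_upwards [hxc.eventually_const_lt hxgt] with v hv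
      exact segmentHorizon_of_lt hv
    refine ((hasDerivAt_arctan_sub_arctan hY hρ hxgt).congr_of_eventuallyEq he).congr_deriv ?_
    rw [horizonDensity_of_lt hxgt, tangentDensity_of_one_le hxgt.le]
    have hh : 0 < √(Y u) := Real.sqrt_pos.2 (by linarith)
    have hY0 : Y u ≠ 0 := by linarith
    have hx0 : Y u - ρ u ^ 2 ≠ 0 := by linarith
    field_simp
    ring

/-- A primitive of the defect of the tangential horizon density from its maximal value. -/
def defectPrimitive (x : ℝ) : ℝ := ∫ u in (0)..x, (2 - tangentDensity u)

theorem hasDerivAt_defectPrimitive (x : ℝ) :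
    HasDerivAt defectPrimitive (2 - tangentDensity x) x := by
  have hc : Continuous fun u => 2 - tangentDensity u :=
    continuous_const.sub continuous_tangentDensity
  exact intervalIntegral.integral_hasDerivAt_right (hc.intervalIntegrable _ _)
    hc.stronglyMeasurable.stronglyMeasurableAtFilter hc.continuousAt

theorem continuous_defectPrimitive : Continuous defectPrimitive :=
  continuous_iff_continuousAt.2 fun x => (hasDerivAt_defectPrimitive x).continuousAt

theorem defectPrimitive_lt {x y : ℝ} (h : x < y) : defectPrimitive x < defectPrimitive y := by
  have hmono : Monotone defectPrimitive :=
    monotone_of_hasDerivAt_nonneg hasDerivAt_defectPrimitive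
      fun x => sub_nonneg.2 (tangentDensity_le_two x)
  refine lt_of_le_of_ne (hmono h.le) fun he => ?_
  obtain ⟨z, hz, hz2⟩ : ∃ z ∈ Ioo x y, z ≠ 2 := by
    by_cases h2 : (x + y) / 2 = 2
    · exact ⟨(3 * x + y) / 4, ⟨by linarith, by linarith⟩, by intro h3; linarith⟩
    · exact ⟨(x + y) / 2, ⟨by linarith, by linarith⟩, h2⟩
  have hconst : defectPrimitive =ᶠ[nhds z] fun _ => defectPrimitive x := by
    filter_upwards [Ioo_mem_nhds hz.1 hz.2] with w hw
    exact le_antisymm ((hmono hw.2.le).trans he.ge) (hmono hw.1.le)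
  have h0 := (hasDerivAt_defectPrimitive z).unique
    ((hasDerivAt_const z (defectPrimitive x)).congr_of_eventuallyEq hconst)
  linarith [tangentDensity_lt_two hz2]

theorem abs_defectPrimitive_sub_le (x y : ℝ) :
    |defectPrimitive y - defectPrimitive x| ≤ 2 * |y - x| := by
  have := (convex_univ (𝕜 := ℝ) (E := ℝ)).norm_image_sub_le_of_norm_hasDerivWithin_le
    (f := defectPrimitive) (C := 2) (x := x) (y := y)
    (fun z _ => (hasDerivAt_defectPrimitive z).hasDerivWithinAt)
    (fun z _ => by
      rw [Real.norm_eq_abs, abs_le]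
      constructor <;> linarith [tangentDensity_le_two z, tangentDensity_nonneg z])
    (mem_univ _) (mem_univ _)
  exact this

/-- The calibration function: along any curve for which half the derivative of the squared distance
has slope at most one, it grows at most as fast as the defect of the horizon density from `2`. -/
def calibration (R Y ρ : ℝ) : ℝ :=
  2 * ρ - segmentHorizon Y ρ + defectPrimitive (Y - ρ ^ 2) / (2 * R)

theorem calibration_zero (R Y : ℝ) : calibration R Y 0 = defectPrimitive Y / (2 * R) := by
  simp [calibration, segmentHorizon_zero]

theorem hasDerivAt_calibration {R : ℝ} (hR : 0 < R) (Y ρ : ℝ) :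
    HasDerivAt (calibration R Y) ((2 - tangentDensity (Y - ρ ^ 2)) * (1 - ρ / R)) ρ := by
  have h1 : HasDerivAt (fun ρ : ℝ => Y - ρ ^ 2) (-(2 * ρ)) ρ := by
    simpa using ((hasDerivAt_id ρ).pow 2).const_sub Y
  have h2 := (hasDerivAt_defectPrimitive (Y - ρ ^ 2)).comp ρ h1
  have h3 := (((hasDerivAt_id ρ).const_mul 2).sub (hasDerivAt_segmentHorizon Y ρ)).add
    (h2.div_const (2 * R))
  refine h3.congr_deriv ?_
  field_simp
  ring

theorem calibration_monotoneOn {R : ℝ} (hR : 0 < R) (Y : ℝ) :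
    MonotoneOn (calibration R Y) (Icc (-R) R) := by
  refine monotoneOn_of_deriv_nonneg (convex_Icc _ _)
    (fun ρ _ => (hasDerivAt_calibration hR Y ρ).continuousAt.continuousWithinAt)
    (fun ρ _ => (hasDerivAt_calibration hR Y ρ).differentiableAt.differentiableWithinAt)
    fun ρ hρ => ?_
  rw [interior_Icc] at hρ
  rw [(hasDerivAt_calibration hR Y ρ).deriv]
  refine mul_nonneg (by linarith [tangentDensity_le_two (Y - ρ ^ 2)]) ?_
  rw [sub_nonneg, div_le_one hR]
  exact hρ.2.le

theorem calibration_sub_le {R : ℝ} (hR : 0 < R) (Y : ℝ) {ρ ρ' : ℝ} (h1 : -R ≤ ρ) (h : ρ ≤ ρ')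
    (h2 : ρ' ≤ R) : calibration R Y ρ' - calibration R Y ρ ≤ 4 * (ρ' - ρ) := by
  have hm : MonotoneOn (fun ρ => 4 * ρ - calibration R Y ρ) (Icc (-R) R) := by
    have hd : ∀ ρ, HasDerivAt (fun ρ => 4 * ρ - calibration R Y ρ)
        (4 - (2 - tangentDensity (Y - ρ ^ 2)) * (1 - ρ / R)) ρ := fun ρ =>
      (((hasDerivAt_id ρ).const_mul 4).sub (hasDerivAt_calibration hR Y ρ)).congr_deriv (by simp)
    refine monotoneOn_of_deriv_nonneg (convex_Icc _ _)
      (fun ρ _ => (hd ρ).continuousAt.continuousWithinAt)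
      (fun ρ _ => (hd ρ).differentiableAt.differentiableWithinAt) fun ρ hρ => ?_
    rw [interior_Icc] at hρ
    rw [(hd ρ).deriv]
    have b1 : -1 ≤ ρ / R := by rw [le_div_iff₀ hR]; linarith [hρ.1]
    have b2 : ρ / R ≤ 1 := by rw [div_le_one hR]; exact hρ.2.le
    nlinarith [tangentDensity_le_two (Y - ρ ^ 2), tangentDensity_nonneg (Y - ρ ^ 2)]
  have := hm ⟨h1, h.trans h2⟩ ⟨h1.trans h, h2⟩ h
  simp only at this
  linarith

theorem abs_calibration_sub_le {R : ℝ} (hR : 0 < R) (Y Y' : ℝ) {ρ : ℝ} (hρ : |ρ| ≤ R) :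
    |calibration R Y' ρ - calibration R Y ρ| ≤ (8 + 4 * R + 1 / R) * |Y' - Y| := by
  have h1 : |segmentHorizon Y' ρ - segmentHorizon Y ρ| ≤ (8 + 4 * R) * |Y' - Y| := by
    rcases le_total Y Y' with h | h
    · rw [abs_of_nonneg (sub_nonneg.2 h)]
      exact abs_segmentHorizon_sub_le hρ h
    · rw [abs_sub_comm, abs_sub_comm Y', abs_of_nonneg (sub_nonneg.2 h)]
      exact abs_segmentHorizon_sub_le hρ h
  have h2 := abs_defectPrimitive_sub_le (Y - ρ ^ 2) (Y' - ρ ^ 2)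
  rw [show Y' - ρ ^ 2 - (Y - ρ ^ 2) = Y' - Y by ring] at h2
  have h3 : |(defectPrimitive (Y' - ρ ^ 2) - defectPrimitive (Y - ρ ^ 2)) / (2 * R)| ≤
      1 / R * |Y' - Y| := by
    rw [abs_div, abs_of_pos (by positivity : 0 < 2 * R), div_le_iff₀ (by positivity)]
    calc _ ≤ 2 * |Y' - Y| := h2
      _ = _ := by field_simp
  have e : calibration R Y' ρ - calibration R Y ρ =
      -(segmentHorizon Y' ρ - segmentHorizon Y ρ) +
      (defectPrimitive (Y' - ρ ^ 2) - defectPrimitive (Y - ρ ^ 2)) / (2 * R) := by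
    simp only [calibration]
    ring
  rw [e]
  refine (abs_add_le _ _).trans ?_
  rw [abs_neg]
  linarith

theorem hasDerivAt_calibration_comp {R : ℝ} (hR : 0 < R) {Y ρ : ℝ → ℝ} {κ p u : ℝ}
    (hY : HasDerivAt Y (2 * κ * ρ u) u) (hρ : HasDerivAt ρ p u) (h1 : Y u ≠ 1)
    (h2 : Y u - ρ u ^ 2 ≠ 1) :
    HasDerivAt (fun u => calibration R (Y u) (ρ u))
      (2 * κ - κ * outerDensity (Y u) (ρ u) -
        (2 - tangentDensity (Y u - ρ u ^ 2)) * (1 - ρ u / R) * (κ - p)) u := by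
  have hx : HasDerivAt (fun u => Y u - ρ u ^ 2) (2 * ρ u * (κ - p)) u := by
    refine (hY.sub (hρ.pow 2)).congr_deriv ?_
    simp
    ring
  have h3 := (hasDerivAt_defectPrimitive (Y u - ρ u ^ 2)).comp u hx
  have h4 := ((hρ.const_mul 2).sub (hasDerivAt_segmentHorizon_comp hY hρ h1 h2)).add
    (h3.div_const (2 * R))
  refine h4.congr_deriv ?_
  field_simp
  ring

theorem lintegral_outerDensity_le {s t κ R : ℝ} {Y ρ : ℝ → ℝ} {M : NNReal} (hst : s ≤ t)
    (hκ : 0 ≤ κ) (hR : 0 < R) (hYlip : LipschitzOnWith M Y (Icc s t))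
    (hY : ∀ᵐ u ∂volume.restrict (Ioc s t), HasDerivAt Y (2 * κ * ρ u) u)
    (hρ : AntitoneOn (fun u => ρ u - κ * u) (Icc s t)) (hb : ∀ u ∈ Icc s t, |ρ u| ≤ R)
    (h1 : ∀ᵐ u ∂volume.restrict (Ioc s t), Y u ≠ 1)
    (h2 : ∀ᵐ u ∂volume.restrict (Ioc s t), Y u - ρ u ^ 2 ≠ 1) :
    ∫⁻ u in Ioc s t, ENNReal.ofReal (κ * outerDensity (Y u) (ρ u)) ≤
      ENNReal.ofReal (2 * κ * (t - s) -
        (calibration R (Y t) (ρ t) - calibration R (Y s) (ρ s))) := by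
  set C := 4 * κ + (8 + 4 * R + 1 / R) * M with hC
  set E : ℝ → ℝ := fun u => calibration R (Y u) (ρ u) with hE
  set g : ℝ → ℝ := fun u => C * u - E u with hg
  have hmono : MonotoneOn g (Icc s t) := by
    intro u hu v hv huv
    have b1 := hb u hu
    have b2 := hb v hv
    have b1' := abs_le.1 b1
    have b2' := abs_le.1 b2
    have hr : ρ v - ρ u ≤ κ * (v - u) := by
      have := hρ hu hv huv
      simp only at this
      linarith
    have e1 : calibration R (Y v) (ρ v) - calibration R (Y v) (ρ u) ≤ 4 * κ * (v - u) := by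
      rcases le_total (ρ v) (ρ u) with h | h
      · have := calibration_monotoneOn hR (Y v) ⟨b2'.1, b2'.2⟩ ⟨b1'.1, b1'.2⟩ h
        have : 0 ≤ 4 * κ * (v - u) := mul_nonneg (by positivity) (by linarith)
        linarith
      · have := calibration_sub_le hR (Y v) b1'.1 h b2'.2
        linarith
    have e2 := abs_calibration_sub_le hR (Y u) (Y v) b1
    have e3 : |Y v - Y u| ≤ M * (v - u) := by
      have := hYlip.dist_le_mul v hv u hu
      rwa [Real.dist_eq, Real.dist_eq, abs_of_nonneg (sub_nonneg.2 huv)] at this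
    have e4 : (8 + 4 * R + 1 / R) * |Y v - Y u| ≤ (8 + 4 * R + 1 / R) * (M * (v - u)) := by
      gcongr
    have e5 := le_abs_self (calibration R (Y v) (ρ u) - calibration R (Y u) (ρ u))
    simp only [hg, hE, hC]
    nlinarith
  have hmono' : MonotoneOn g (uIcc s t) := by rwa [uIcc_of_le hst]
  have hint := hmono'.intervalIntegrable_deriv
  have hle := hmono'.intervalIntegral_deriv_mem_uIcc
  rw [uIcc_of_le (sub_nonneg.2 (hmono (left_mem_Icc.2 hst) (right_mem_Icc.2 hst) hst))] at hle
  have hdiff : ∀ᵐ u ∂volume.restrict (Ioc s t),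
      DifferentiableWithinAt ℝ (fun u => ρ u - κ * u) (Icc s t) u := by
    have := hρ.neg.ae_differentiableWithinAt_of_mem
    rw [ae_restrict_iff' measurableSet_Ioc]
    filter_upwards [this] with u hu hmem
    exact (hu (Ioc_subset_Icc_self hmem)).neg.congr (fun x _ => by simp) (by simp)
  have hne : ∀ᵐ u ∂volume.restrict (Ioc s t), u ≠ t :=
    ae_restrict_of_ae (by simp [ae_iff])
  have hpt : ∀ᵐ u ∂volume.restrict (Ioc s t),
      κ * outerDensity (Y u) (ρ u) ≤ 2 * κ - C + deriv g u := by
    filter_upwards [hY, h1, h2, hdiff, hne, ae_restrict_mem measurableSet_Ioc]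
      with u hYu h1u h2u hdu hneu hmem
    have hnhds : Icc s t ∈ nhds u := Icc_mem_nhds hmem.1 (lt_of_le_of_ne hmem.2 hneu)
    have hd0 : HasDerivAt (fun u => ρ u - κ * u) (deriv (fun u => ρ u - κ * u) u) u :=
      (hdu.differentiableAt hnhds).hasDerivAt
    have hneg : deriv (fun u => ρ u - κ * u) u ≤ 0 := by
      rw [← derivWithin_of_mem_nhds hnhds]
      exact hρ.derivWithin_nonpos
    set d := deriv (fun u => ρ u - κ * u) u
    have hdρ : HasDerivAt ρ (d + κ) u := by
      have := hd0.add ((hasDerivAt_id u).const_mul κ)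
      exact (this.congr_of_eventuallyEq (Filter.Eventually.of_forall fun x => by simp)).congr_deriv
        (by simp)
    have hEd := hasDerivAt_calibration_comp hR hYu hdρ h1u h2u
    have hgd := (((hasDerivAt_id u).const_mul C).sub hEd).deriv
    have hgd' : deriv g u = C * 1 - (2 * κ - κ * outerDensity (Y u) (ρ u) -
        (2 - tangentDensity (Y u - ρ u ^ 2)) * (1 - ρ u / R) * (κ - (d + κ))) := hgd
    rw [hgd']
    have p1 : 0 ≤ 2 - tangentDensity (Y u - ρ u ^ 2) := by
      linarith [tangentDensity_le_two (Y u - ρ u ^ 2)]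
    have p2 : 0 ≤ 1 - ρ u / R := by
      rw [sub_nonneg, div_le_one hR]
      exact (abs_le.1 (hb u (Ioc_subset_Icc_self hmem))).2
    have p3 : 0 ≤ κ - (d + κ) := by linarith
    have := mul_nonneg (mul_nonneg p1 p2) p3
    linarith
  have hint' : IntegrableOn (fun u => 2 * κ - C + deriv g u) (Ioc s t) :=
    (integrableOn_const (by simp)).add ((intervalIntegrable_iff_integrableOn_Ioc_of_le hst).1 hint)
  calc ∫⁻ u in Ioc s t, ENNReal.ofReal (κ * outerDensity (Y u) (ρ u))
      ≤ ∫⁻ u in Ioc s t, ENNReal.ofReal (2 * κ - C + deriv g u) :=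
        lintegral_mono_ae (hpt.mono fun u hu => ENNReal.ofReal_le_ofReal hu)
    _ = ENNReal.ofReal (∫ u in Ioc s t, (2 * κ - C + deriv g u)) := by
        rw [ofReal_integral_eq_lintegral_ofReal hint']
        exact hpt.mono fun u hu => (mul_nonneg hκ (outerDensity_nonneg _ _)).trans hu
    _ ≤ _ := by
        refine ENNReal.ofReal_le_ofReal ?_
        rw [← intervalIntegral.integral_of_le hst, intervalIntegral.integral_add (by simp) hint,
          intervalIntegral.integral_const, smul_eq_mul]
        have := hle.2
        simp only [hg, hE] at this ⊢
        nlinarith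

theorem levelDensity_eq_ofReal_outerDensity {c : ℝ} (hc : 0 < c) (y r : ℝ) :
    levelDensity c y r = ENNReal.ofReal (1 / c * outerDensity (y / c ^ 2) (r / c)) := by
  have h : 1 < y / c ^ 2 ↔ c ^ 2 < y := one_lt_div (by positivity)
  unfold levelDensity outerDensity
  by_cases hy : c ^ 2 < y
  · rw [indicator_of_mem (by exact hy), if_pos (h.2 hy)]
  · rw [indicator_of_notMem (by exact hy), if_neg (mt h.1 hy)]
    simp

theorem levelDensity_neg (c y r : ℝ) : levelDensity c y (-r) = levelDensity c y r := by
  simp only [levelDensity, horizonDensity, neg_div, absCosIntegral_neg_left, neg_sq]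

/-- A semiconcave function running from an interior minimum to a maximum has a half derivative
which vanishes at the ends of the interval and whose slope is at most one. -/
theorem exists_half_deriv {y : ℝ → ℝ} {s t δ : ℝ} {M : NNReal} (hst : s < t) (hδ : 0 < δ)
    (hlip : LipschitzWith M y)
    (hc : ConvexOn ℝ (Icc (s - δ) t) fun u => u ^ 2 - y u)
    (hmin : ∀ u, y s ≤ y u) (hmax : ∀ u, y u ≤ y t) :
    ∃ r : ℝ → ℝ, r s = 0 ∧ r t = 0 ∧ AntitoneOn (fun u => r u - u) (Icc s t) ∧
      (∀ u ∈ Icc s t, |r u| ≤ t - s) ∧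
      ∀ᵐ u ∂volume.restrict (Ioc s t), HasDerivAt y (2 * r u) u := by
  set F : ℝ → ℝ := fun u => u ^ 2 - y u with hF
  set D : ℝ → ℝ := fun u => derivWithin F (Ioi u) u with hD
  set r : ℝ → ℝ := (Ioo s t).indicator fun u => u - D u / 2 with hr
  have hint : ∀ u ∈ Ioo s t, u ∈ interior (Icc (s - δ) t) := fun u hu => by
    rw [interior_Icc]
    exact ⟨by linarith [hu.1], hu.2⟩
  have hrs : r s = 0 := indicator_of_notMem (by simp) _
  have hrt : r t = 0 := indicator_of_notMem (by simp) _
  have hri : ∀ u ∈ Ioo s t, r u = u - D u / 2 := fun u hu => indicator_of_mem hu _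
  have hupper : ∀ u ∈ Ioo s t, r u ≤ u - s := by
    intro u hu
    refine le_of_forall_pos_le_add fun e he => ?_
    set h := min δ (2 * e) with hh
    have h0 : 0 < h := lt_min hδ (by linarith)
    have hhδ : h ≤ δ := min_le_left _ _
    have hhe : h ≤ 2 * e := min_le_right _ _
    have h1 := hc.slope_mono_adjacent (x := s - h) (y := s) (z := u)
      ⟨by linarith, by linarith⟩ ⟨by linarith [hu.1], hu.2.le⟩ (by linarith) hu.1
    have hd : HasDerivWithinAt F (D u) (Ioi u) u :=
      hc.hasDerivWithinAt_rightDeriv_of_mem_interior (hint u hu)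
    have h2 : (F u - F s) / (u - s) ≤ D u := by
      have hL := hc.slope_le_leftDeriv_of_mem_interior
        (x := s) (y := u) ⟨by linarith, hst.le⟩ (hint u hu) hu.1
      rw [slope_def_field] at hL
      exact hL.trans (hc.leftDeriv_le_rightDeriv_of_mem_interior (hint u hu))
    have h3 : 2 * s - h ≤ (F s - F (s - h)) / (s - (s - h)) := by
      rw [le_div_iff₀ (by linarith)]
      simp only [hF]
      nlinarith [hmin (s - h)]
    rw [hri u hu]
    linarith
  have hlower : ∀ u ∈ Ioo s t, u - t ≤ r u := by
    intro u hu
    have h1 : D u ≤ (F t - F u) / (t - u) := by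
      have := hc.rightDeriv_le_slope_of_mem_interior (hint u hu)
        (y := t) ⟨by linarith, le_rfl⟩ hu.2
      rwa [slope_def_field] at this
    have h2 : (F t - F u) / (t - u) ≤ 2 * t := by
      rw [div_le_iff₀ (by linarith [hu.2])]
      simp only [hF]
      nlinarith [hmax u, hu.2]
    rw [hri u hu]
    linarith
  have hanti : AntitoneOn (fun u => r u - u) (Icc s t) := by
    intro u hu v hv huv
    simp only
    rcases eq_or_lt_of_le huv with rfl | huv'
    · rfl
    rcases eq_or_lt_of_le hu.1 with rfl | hu1
    · rw [hrs]
      rcases eq_or_lt_of_le hv.2 with rfl | hv2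
      · rw [hrt]
        linarith
      · linarith [hupper v ⟨huv', hv2⟩]
    · have hu2 : u < t := huv'.trans_le hv.2
      rcases eq_or_lt_of_le hv.2 with rfl | hv2
      · rw [hrt]
        linarith [hlower u ⟨hu1, hu2⟩]
      · have := hc.monotoneOn_rightDeriv (hint u ⟨hu1, hu2⟩)
          (hint v ⟨hu1.trans huv', hv2⟩) huv
        rw [hri u ⟨hu1, hu2⟩, hri v ⟨hu1.trans huv', hv2⟩]
        simp only [hD] at this ⊢
        linarith
  refine ⟨r, hrs, hrt, hanti, fun u hu => ?_, ?_⟩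
  · have h1 := hanti (left_mem_Icc.2 hst.le) hu hu.1
    have h2 := hanti hu (right_mem_Icc.2 hst.le) hu.2
    simp only [hrs, hrt] at h1 h2
    rw [abs_le]
    constructor <;> linarith [hu.1, hu.2]
  · have hne : ∀ᵐ u ∂volume.restrict (Ioc s t), u ≠ t := ae_restrict_of_ae (by simp [ae_iff])
    filter_upwards [ae_restrict_of_ae hlip.ae_differentiableAt_real, hne,
      ae_restrict_mem measurableSet_Ioc] with u hu hut hmem
    have hu' : u ∈ Ioo s t := ⟨hmem.1, lt_of_le_of_ne hmem.2 hut⟩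
    have hFd : HasDerivAt F (2 * u - deriv y u) u :=
      (((hasDerivAt_id u).pow 2).sub hu.hasDerivAt).congr_deriv (by simp)
    have : D u = 2 * u - deriv y u :=
      hFd.hasDerivWithinAt.derivWithin (uniqueDiffWithinAt_Ioi u)
    rw [hri u hu', this]
    exact hu.hasDerivAt.congr_deriv (by ring)

theorem ae_ae_ne_sq {g : ℝ → ℝ} (hg : Measurable g) (T : Set ℝ) :
    ∀ᵐ c ∂volume, 0 < c → ∀ᵐ u ∂volume.restrict T, g u ≠ c ^ 2 := by
  have hcount := Measure.countable_meas_level_set_pos (μ := volume.restrict T)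
    (g := fun u => √(g u)) (by fun_prop)
  filter_upwards [hcount.ae_notMem volume] with c hc hc0
  have h0 : volume.restrict T {u | √(g u) = c} = 0 := by
    by_contra h
    exact hc (pos_iff_ne_zero.2 h)
  refine ae_iff.2 (measure_mono_null (fun u hu => ?_) h0)
  have hu' : g u = c ^ 2 := not_not.1 hu
  change √(g u) = c
  rw [hu', sqrt_sq hc0.le]

theorem lintegral_levelDensity_le {y : ℝ → ℝ} {s t δ R : ℝ} {M : NNReal} (hst : s < t)
    (hδ : 0 < δ) (hlip : LipschitzWith M y)
    (hc : ConvexOn ℝ (Icc (s - δ) t) fun u => u ^ 2 - y u)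
    (hmin : ∀ u, y s ≤ y u) (hmax : ∀ u, y u ≤ y t) (hR : 2 * (t - s) ≤ R) :
    ∀ᵐ c ∂volume, 1 / 2 ≤ c → ∫⁻ u in Ioc s t, levelDensity c (y u) (deriv y u / 2) ≤
      ENNReal.ofReal (2 * (1 / c) * (t - s) -
        (defectPrimitive (y t / c ^ 2) - defectPrimitive (y s / c ^ 2)) / (2 * R)) := by
  obtain ⟨r, hrs, hrt, hanti, hb, hder⟩ := exists_half_deriv hst hδ hlip hc hmin hmax
  have hym : Measurable y := hlip.continuous.measurable
  filter_upwards [ae_ae_ne_sq hym (Ioc s t),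
    ae_ae_ne_sq (g := fun u => y u - (deriv y u / 2) ^ 2)
      (hym.sub (((measurable_deriv y).div_const 2).pow_const 2)) (Ioc s t)] with c h1 h2 hc2
  have hc0 : 0 < c := by linarith
  have hci : 1 / c ≤ 2 := by
    rw [div_le_iff₀ hc0]
    linarith
  have hYlip : LipschitzWith (‖(c ^ 2)⁻¹‖₊ * M) fun u => (c ^ 2)⁻¹ * y u :=
    (lipschitzWith_smul ((c ^ 2)⁻¹)).comp hlip
  have key := lintegral_outerDensity_le (s := s) (t := t) (κ := 1 / c) (R := R)
    (Y := fun u => y u / c ^ 2) (ρ := fun u => r u / c) (M := ‖(c ^ 2)⁻¹‖₊ * M) hst.le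
    (by positivity) (by linarith)
    (by simpa only [div_eq_inv_mul] using hYlip.lipschitzOnWith)
    (hder.mono fun u hu => (hu.div_const (c ^ 2)).congr_deriv (by field_simp))
    (fun u hu v hv huv => by
      have := div_le_div_of_nonneg_right (hanti hu hv huv) hc0.le
      simp only [sub_div] at this
      simpa only [one_div_mul_eq_div] using this)
    (fun u hu => by
      rw [abs_div, abs_of_pos hc0, div_eq_mul_one_div]
      calc |r u| * (1 / c) ≤ (t - s) * 2 :=
            mul_le_mul (hb u hu) hci (by positivity) (by linarith)
        _ ≤ R := by linarith)
    ((h1 hc0).mono fun u hu h => hu (by rwa [div_eq_one_iff_eq (by positivity)] at h))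
    (by
      filter_upwards [h2 hc0, hder] with u hu hd h
      refine hu ?_
      rw [hd.deriv]
      field_simp at h ⊢
      linarith)
  simp only [hrs, hrt, zero_div, calibration_zero] at key
  rw [sub_div]
  refine le_trans (le_of_eq ?_) key
  refine lintegral_congr_ae (hder.mono fun u hu => ?_)
  simp only
  rw [levelDensity_eq_ofReal_outerDensity hc0, hu.deriv, mul_div_cancel_left₀ _ two_ne_zero]

theorem IsMinInspectionCurve.convexOn_sq_sub_normSq {L : ℝ} {γ : AddCircle L → E3}
    (hγ : IsMinInspectionCurve L γ) {p q : ℝ} (hpq : q - p ≤ L) :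
    ConvexOn ℝ (Icc p q) fun u => u ^ 2 - ‖liftCurve L γ u‖ ^ 2 := by
  refine convexOn_of_slope_mono_adjacent (convex_Icc p q) fun {x y z} hx hz hxy hyz => ?_
  have h := hγ.slope_normSq_le (m := y) (a := y - x) (b := z - y) (by linarith) (by linarith)
    (by linarith [hx.1, hz.2])
  rw [show y + (z - y) = z by ring, show y - (y - x) = x by ring] at h
  have e1 : ∀ {v w A B : ℝ}, v < w →
      (w ^ 2 - A - (v ^ 2 - B)) / (w - v) = w + v - (A - B) / (w - v) := by
    intro v w A B hvw
    have : w - v ≠ 0 := (sub_pos.2 hvw).ne'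
    field_simp
    ring
  rw [e1 hxy, e1 hyz]
  linarith

theorem IsInspectionCurve.exists_lipschitzWith_normSq {L : ℝ} {γ : AddCircle L → E3}
    (hγ : IsInspectionCurve L γ) :
    ∃ M, LipschitzWith M fun u => ‖liftCurve L γ u‖ ^ 2 := by
  obtain ⟨B, hB⟩ := exists_norm_liftCurve_le hγ
  refine ⟨_, LipschitzWith.of_dist_le' (K := 2 * B) fun u v => ?_⟩
  have h := (liftCurve_lipschitz hγ).dist_le_mul u v
  rw [NNReal.coe_one, one_mul, dist_eq_norm] at h
  have h2 := abs_norm_sub_norm_le (liftCurve L γ u) (liftCurve L γ v)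
  rw [Real.dist_eq, sq_sub_sq, abs_mul, abs_of_nonneg (by positivity)]
  exact mul_le_mul (by linarith [hB u, hB v]) (h2.trans h) (abs_nonneg _)
    (by linarith [(norm_nonneg _).trans (hB u)])

theorem lintegral_Ioc_comp_neg (g : ℝ → ℝ≥0∞) (s t : ℝ) :
    ∫⁻ u in Ioc s t, g u = ∫⁻ u in Ioc (-t) (-s), g (-u) := by
  rw [← (Measure.measurePreserving_neg (volume : Measure ℝ)).setLIntegral_comp_preimage_emb
    (Homeomorph.neg ℝ).measurableEmbedding g, restrict_Ioc_eq_restrict_Icc]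
  simp [restrict_Ico_eq_restrict_Icc]

theorem IsMinInspectionCurve.lintegral_levelDensity_le {L : ℝ} {γ : AddCircle L → E3}
    (hγ : IsMinInspectionCurve L γ) {s t : ℝ} (hst : s < t) (htL : t < s + L)
    (hmin : ∀ u, ‖liftCurve L γ s‖ ^ 2 ≤ ‖liftCurve L γ u‖ ^ 2)
    (hmax : ∀ u, ‖liftCurve L γ u‖ ^ 2 ≤ ‖liftCurve L γ t‖ ^ 2) :
    ∀ᵐ c ∂volume, 1 / 2 ≤ c → ∫⁻ u in Ioc s (s + L), levelDensity c (‖liftCurve L γ u‖ ^ 2)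
      (deriv (fun u => ‖liftCurve L γ u‖ ^ 2) u / 2) ≤
      ENNReal.ofReal (2 * (1 / c) * (t - s) - (defectPrimitive (‖liftCurve L γ t‖ ^ 2 / c ^ 2) -
        defectPrimitive (‖liftCurve L γ s‖ ^ 2 / c ^ 2)) / (2 * (2 * L))) +
      ENNReal.ofReal (2 * (1 / c) * (s + L - t) -
        (defectPrimitive (‖liftCurve L γ t‖ ^ 2 / c ^ 2) -
        defectPrimitive (‖liftCurve L γ s‖ ^ 2 / c ^ 2)) / (2 * (2 * L))) := by
  obtain ⟨M, hM⟩ := hγ.1.exists_lipschitzWith_normSq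
  have hper : ‖liftCurve L γ (s + L)‖ ^ 2 = ‖liftCurve L γ s‖ ^ 2 := by
    rw [liftCurve_periodic L γ s]
  have hcv := fun {p q : ℝ} (h : q - p ≤ L) => hγ.convexOn_sq_sub_normSq h
  set y : ℝ → ℝ := fun u => ‖liftCurve L γ u‖ ^ 2 with hy
  have h1 := _root_.lintegral_levelDensity_le (δ := s + L - t) (R := 2 * L) hst (by linarith) hM
    (hcv (by linarith)) hmin hmax (by linarith)
  have hMneg : LipschitzWith (M * 1) fun u => y (-u) := hM.comp (LipschitzWith.id.neg)
  have hcneg : ConvexOn ℝ (Icc (-(s + L) - (t - s)) (-t)) fun u => u ^ 2 - y (-u) := by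
    have := (hcv (p := t) (q := s + L + (t - s)) (by linarith)).comp_linearMap
      (-LinearMap.id : ℝ →ₗ[ℝ] ℝ)
    refine (this.congr fun u _ => by simp [hy]).subset (fun u hu => ?_) (convex_Icc _ _)
    simp only [mem_preimage, LinearMap.neg_apply, LinearMap.id_apply]
    exact ⟨by linarith [hu.2], by linarith [hu.1]⟩
  have h2 := _root_.lintegral_levelDensity_le (y := fun u => y (-u)) (s := -(s + L)) (t := -t)
    (δ := t - s) (R := 2 * L) (by linarith) (by linarith) hMneg hcneg
    (fun u => by
      rw [neg_neg]
      exact hper.le.trans (hmin (-u)))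
    (fun u => by simpa only [neg_neg] using hmax (-u)) (by linarith)
  filter_upwards [h1, h2] with c h1 h2 hc
  rw [← Ioc_union_Ioc_eq_Ioc hst.le htL.le]
  refine (lintegral_union_le _ _ _).trans (add_le_add (h1 hc) ?_)
  rw [lintegral_Ioc_comp_neg]
  have h3 := h2 hc
  simp only [neg_neg, deriv_comp_neg, neg_div, levelDensity_neg] at h3
  rw [show -t - -(s + L) = s + L - t by ring] at h3
  rwa [show y (s + L) = y s from hper] at h3

theorem IsMinInspectionCurve.norm_liftCurve_eq {L : ℝ} {γ : AddCircle L → E3}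
    (hγ : IsMinInspectionCurve L γ) (u v : ℝ) : ‖liftCurve L γ u‖ = ‖liftCurve L γ v‖ := by
  have hL := hγ.1.1
  have hcont : Continuous fun u => ‖liftCurve L γ u‖ := (liftCurve_lipschitz hγ.1).continuous.norm
  have hper : Function.Periodic (fun u => ‖liftCurve L γ u‖) L := fun u => by
    simp only [liftCurve_periodic L γ u]
  obtain ⟨s, -, hs⟩ := isCompact_Icc.exists_isMinOn (nonempty_Icc.2 hL.le) hcont.continuousOn
  have hmin : ∀ u, ‖liftCurve L γ s‖ ≤ ‖liftCurve L γ u‖ := fun u => by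
    obtain ⟨w, hw, hwu⟩ := hper.exists_mem_Ico₀ hL u
    rw [hwu]
    exact hs (Ico_subset_Icc_self hw)
  obtain ⟨t, ht, htmax⟩ := isCompact_Icc.exists_isMaxOn
    (nonempty_Icc.2 (le_add_of_nonneg_right hL.le : s ≤ s + L)) hcont.continuousOn
  have hmax : ∀ u, ‖liftCurve L γ u‖ ≤ ‖liftCurve L γ t‖ := fun u => by
    obtain ⟨w, hw, hwu⟩ := hper.exists_mem_Ico hL u s
    rw [hwu]
    exact htmax (Ico_subset_Icc_self hw)
  suffices h : ‖liftCurve L γ t‖ ≤ ‖liftCurve L γ s‖ from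
    le_antisymm ((hmax u).trans (h.trans (hmin v))) ((hmax v).trans (h.trans (hmin u)))
  by_contra! hlt
  have hst : s < t := lt_of_le_of_ne ht.1 fun h => by simp [h] at hlt
  have htL : t < s + L := lt_of_le_of_ne ht.2 fun h => by
    rw [h, liftCurve_periodic L γ s] at hlt
    exact lt_irrefl _ hlt
  have hae := hγ.lintegral_levelDensity_le hst htL
    (fun u => pow_le_pow_left₀ (norm_nonneg _) (hmin u) 2)
    (fun u => pow_le_pow_left₀ (norm_nonneg _) (hmax u) 2)
  have hint := fun {ε : ℝ} (h0 : 0 ≤ ε) (h1 : ε < 1) => ofReal_le_lintegral_levelDensity hγ.1 s h0 h1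
  have hsq : ‖liftCurve L γ s‖ ^ 2 < ‖liftCurve L γ t‖ ^ 2 := by gcongr
  set P := ‖liftCurve L γ s‖ ^ 2
  set Q := ‖liftCurve L γ t‖ ^ 2
  set A : ℝ → ℝ := fun c => 2 * (1 / c) * (t - s) -
    (defectPrimitive (Q / c ^ 2) - defectPrimitive (P / c ^ 2)) / (2 * (2 * L)) with hA
  set B : ℝ → ℝ := fun c => 2 * (1 / c) * (s + L - t) -
    (defectPrimitive (Q / c ^ 2) - defectPrimitive (P / c ^ 2)) / (2 * (2 * L)) with hB
  set h : ℝ → ℝ := fun c => max (A c) 0 + max (B c) 0 with hh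
  have hcontA : ContinuousAt A 1 := by
    have h1 := continuous_defectPrimitive
    simp only [hA]
    fun_prop (disch := norm_num)
  have hcontB : ContinuousAt B 1 := by
    have h1 := continuous_defectPrimitive
    simp only [hB]
    fun_prop (disch := norm_num)
  have hconth : ContinuousAt h 1 := (hcontA.max continuousAt_const).add
    (hcontB.max continuousAt_const)
  have hh1 : h 1 < 8 * π := by
    have hgap : 0 < (defectPrimitive (Q / 1 ^ 2) - defectPrimitive (P / 1 ^ 2)) / (2 * (2 * L)) := by
      have := defectPrimitive_lt hsq
      simp only [one_pow, div_one]
      exact div_pos (by linarith) (by positivity)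
    have hlen := hγ.length_le
    have hA1 : max (A 1) 0 < 2 * (t - s) := max_lt (by simp only [hA]; linarith) (by linarith)
    have hB1 : max (B 1) 0 < 2 * (s + L - t) := max_lt (by simp only [hB]; linarith) (by linarith)
    simp only [hh]
    linarith
  obtain ⟨q, hq1, hq2⟩ := exists_between hh1
  have hq0 : 0 ≤ q := le_trans (add_nonneg (le_max_right _ _) (le_max_right _ _)) hq1.le
  obtain ⟨e, he, hball⟩ := Metric.eventually_nhds_iff.1 (hconth.eventually_lt_const hq1)
  set ε := min (e / 2) (1 / 2) with hε
  have hε0 : 0 < ε := lt_min (by linarith) (by norm_num)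
  have hεe : ε < e := (min_le_left _ _).trans_lt (by linarith)
  have hε2 : ε ≤ 1 / 2 := min_le_right _ _
  have hle : ENNReal.ofReal (8 * π * ε) ≤ ENNReal.ofReal (q * ε) := by
    refine (hint hε0.le (by linarith)).trans ?_
    calc _ ≤ ∫⁻ _ in Icc (1 - ε) 1, ENNReal.ofReal q := by
          refine lintegral_mono_ae ?_
          filter_upwards [ae_restrict_of_ae hae, ae_restrict_mem measurableSet_Icc] with c hc hmem
          refine (hc (by linarith [hmem.1])).trans ?_
          refine (add_le_add (ENNReal.ofReal_le_ofReal (le_max_left (A c) 0))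
            (ENNReal.ofReal_le_ofReal (le_max_left (B c) 0))).trans ?_
          rw [← ENNReal.ofReal_add (le_max_right _ _) (le_max_right _ _)]
          refine ENNReal.ofReal_le_ofReal (hball ?_).le
          rw [Real.dist_eq, abs_lt]
          constructor <;> linarith [hmem.1, hmem.2]
      _ = ENNReal.ofReal (q * ε) := by
          rw [setLIntegral_const, Real.volume_Icc, ← ENNReal.ofReal_mul hq0, _root_.sub_sub_cancel]
  rw [ENNReal.ofReal_le_ofReal_iff (by positivity)] at hle
  exact absurd (le_of_mul_le_mul_right hle hε0) (not_le.2 hq2)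

theorem exists_mem_Icc_pred_of_mem_Icc {tk : ℕ → ℝ} {s : ℝ} (m : ℕ) (hm : 0 < m)
    (hs : s ∈ Icc (tk 0) (tk m)) :
    ∃ k, 1 ≤ k ∧ k ≤ m ∧ s ∈ Icc (tk (k - 1)) (tk k) := by
  induction m, hm using Nat.le_induction with
  | base => exact ⟨1, le_rfl, le_rfl, hs⟩
  | succ n hn ih =>
    rcases le_total s (tk n) with h | h
    · obtain ⟨k, h1, h2, h3⟩ := ih ⟨hs.1, h⟩
      exact ⟨k, h1, h2.trans n.le_succ, h3⟩
    · exact ⟨n + 1, by simp, le_rfl, h, hs.2⟩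

theorem IsUnfolding.norm_eq {L : ℝ} {γ : AddCircle L → E3} {γt : ℝ → ℂ}
    (h : IsUnfolding L γ γt) {s : ℝ} (hs : s ∈ Icc 0 L) : ‖γt s‖ = ‖liftCurve L γ s‖ := by
  obtain ⟨m, tk, hm, -, h0, hL, -, hform⟩ := h
  obtain ⟨k, hk1, hkm, hk⟩ := exists_mem_Icc_pred_of_mem_Icc (tk := tk) m hm (by rwa [h0, hL])
  rw [hform k hk1 hkm s hk, norm_mul, mul_comm Complex.I, Complex.norm_exp_ofReal_mul_I, mul_one,
    Complex.norm_real, norm_norm]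

/-- Let `σ : [a,b] → ℝ²` be a strict spiral occurring in a spiral
decomposition of the unfolding `γt` of a minimal inspection curve `γ`. Then the
efficiency satisfies `E(σ) ≤ 2`; moreover if `|σ(a)| < 1` then `E(σ) < 2`. -/
theorem spiral_efficiency_le_two
    (L : ℝ) (γ : AddCircle L → E3) (hγ : IsMinInspectionCurve L γ)
    (h0 : IsLocalMin (fun s : ℝ => ‖liftCurve L γ s‖) 0)
    (γt : ℝ → ℂ) (hunf : IsUnfolding L γ γt)
    (ι : Type) (U : ι → Set ℝ) (hdec : IsSpiralDecomp L γt ι U)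
    (i : ι) (a b : ℝ) (hcl : closure (U i) = Set.Icc a b)
    (σ : ℝ → ℂ) (ψ : ℝ → ℝ)
    (hψ : ψ = id ∨ ψ = fun s => a + b - s)
    (hσγ : ∀ s ∈ Set.Icc a b, σ s = γt (ψ s))
    (hσ : IsStrictSpiral σ a b) :
    effPlanar σ (Set.Icc a b) ≤ 2 ∧
      (‖σ a‖ < 1 → effPlanar σ (Set.Icc a b) < 2) := by
  exfalso
  have hab : a < b := hσ.1.1
  have hsub : Icc a b ⊆ Icc 0 L := by
    obtain ⟨V, -, hV⟩ := hdec.2.1 i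
    rw [← hcl, hV]
    exact closure_minimal inter_subset_right isClosed_Icc
  have hnorm : ∀ s ∈ Icc a b, ‖σ s‖ = ‖liftCurve L γ (ψ s)‖ := fun s hs => by
    rw [hσγ s hs]
    refine hunf.norm_eq (hsub ?_)
    rcases hψ with rfl | rfl
    · exact hs
    · exact ⟨by linarith [hs.2], by linarith [hs.1]⟩
  have ha := left_mem_Icc.2 hab.le
  have hb := right_mem_Icc.2 hab.le
  have hlt : ‖σ a‖ < ‖σ b‖ := hσ.2 ha hb hab
  rw [hnorm a ha, hnorm b hb] at hlt
  exact hlt.ne (hγ.norm_liftCurve_eq _ _)
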